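/- arXiv:2409.06200 — 4 statements merged into one kernel-verified Lean document; each statement's English description precedes it below -/
import Mathlib

section
/- The Grigorchuk group Γ is hereditarily conjugacy separable; in particular, Γ is 2-hereditarily conjugacy separable (every subgroup of Γ containing a normal subgroup with finite 2-group quotient is 2-conjugacy separable). -/
open Pointwise

universe u

structure ECPseudoVariety : Type (u + 1) where
  mem : ∀ (G : Type u) [Group G], Prop
  finite : ∀ (G : Type u) [Group G], mem G → Finite G
  iso_closed : ∀ (G H : Type u) [Group G] [Group H], G ≃* H → mem G → mem H
  subgroup_closed : ∀ (G : Type u) [Group G] (H : Subgroup G), mem G → mem ↥H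
  quotient_closed : ∀ (G : Type u) [Group G] (N : Subgroup G) [N.Normal],
    mem G → mem (G ⧸ N)
  prod_closed : ∀ (G H : Type u) [Group G] [Group H], mem G → mem H → mem (G × H)
  extension_closed : ∀ (G : Type u) [Group G] (N : Subgroup G) [N.Normal],
    mem ↥N → mem (G ⧸ N) → mem G

namespace ECPseudoVariety

variable (V : ECPseudoVariety.{u})

def coC (G : Type u) [Group G] : Set (Subgroup G) :=
  {N | ∃ hN : N.Normal, haveI := hN; V.mem (G ⧸ N)}

def CSeparable {G : Type u} [Group G] (X : Set G) : Prop :=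
  ∀ g : G, g ∉ X → ∃ N ∈ V.coC G, (QuotientGroup.mk g : G ⧸ N) ∉ QuotientGroup.mk '' X

def Residually (G : Type u) [Group G] : Prop :=
  ∀ g : G, g ≠ 1 → ∃ N ∈ V.coC G, g ∉ N

def ConjSep (G : Type u) [Group G] : Prop :=
  ∀ g : G, V.CSeparable {x : G | IsConj g x}

def COpen {G : Type u} [Group G] (H : Subgroup G) : Prop :=
  ∃ N ∈ V.coC G, N ≤ H

def HCS (G : Type u) [Group G] : Prop :=
  V.ConjSep G ∧ ∀ H : Subgroup G, V.COpen H → V.ConjSep ↥H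

def CyclicSep (G : Type u) [Group G] : Prop :=
  ∀ g : G, V.CSeparable ((Subgroup.zpowers g : Subgroup G) : Set G)

end ECPseudoVariety

def CCWitness {G : Type u} [Group G] (g : G) (K L : Subgroup G) [L.Normal] : Prop :=
  (Subgroup.centralizer {(QuotientGroup.mk g : G ⧸ L)} : Set (G ⧸ L)) ⊆
    QuotientGroup.mk '' ((Subgroup.centralizer {g} : Set G) * (K : Set G))

namespace ECPseudoVariety

variable (V : ECPseudoVariety.{u})

def SatisfiesCCAt {G : Type u} [Group G] (g : G) : Prop :=
  ∀ K ∈ V.coC G, ∃ L ∈ V.coC G, L ≤ K ∧ ∃ hL : L.Normal, haveI := hL; CCWitness g K L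

def SatisfiesCC (G : Type u) [Group G] : Prop :=
  ∀ g : G, V.SatisfiesCCAt g

end ECPseudoVariety

/-- `G` is conjugacy separable. -/
def IsConjSeparable (G : Type u) [Group G] : Prop :=
  ∀ x y : G, ¬ IsConj x y → ∃ N : Subgroup G, ∃ hN : N.Normal, N.FiniteIndex ∧
    (haveI := hN; ¬ IsConj (QuotientGroup.mk x : G ⧸ N) (QuotientGroup.mk y))

/-- `G` is hereditarily conjugacy separable: every finite-index subgroup is
conjugacy separable. -/
def IsHereditarilyConjSeparable (G : Type u) [Group G] : Prop :=
  ∀ H : Subgroup G, H.FiniteIndex → IsConjSeparable H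

/-- `G` is residually finite. -/
def IsResiduallyFinite (G : Type u) [Group G] : Prop :=
  ∀ g : G, g ≠ 1 → ∃ N : Subgroup G, N.Normal ∧ N.FiniteIndex ∧ g ∉ N

/-- Normal subgroups with finite `p`-group quotient. -/
def pCoC (p : ℕ) (G : Type u) [Group G] : Set (Subgroup G) :=
  {N | ∃ hN : N.Normal, Finite (G ⧸ N) ∧ (haveI := hN; IsPGroup p (G ⧸ N))}

/-- `G` is `p`-conjugacy separable. -/
def pConjSep (p : ℕ) (G : Type u) [Group G] : Prop :=
  ∀ x y : G, ¬ IsConj x y → ∃ N ∈ pCoC p G, ∃ hN : N.Normal,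
    haveI := hN; ¬ IsConj (QuotientGroup.mk x : G ⧸ N) (QuotientGroup.mk y)

/-- A subgroup is `p`-open if it contains a normal subgroup with finite
`p`-group quotient. -/
def pOpen (p : ℕ) {G : Type u} [Group G] (H : Subgroup G) : Prop :=
  ∃ N ∈ pCoC p G, N ≤ H

/-- `G` is `p`-hereditarily conjugacy separable. -/
def pHCS (p : ℕ) (G : Type u) [Group G] : Prop :=
  pConjSep p G ∧ ∀ H : Subgroup G, pOpen p H → pConjSep p H

/-- The base group of the restricted wreath product: finitely supported functions `B → A`. -/
def WreathBase (A B : Type u) [Group A] : Subgroup (B → A) where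
  carrier := {f | (Function.mulSupport f).Finite}
  one_mem' := by simp
  mul_mem' := fun hf hg =>
    Set.Finite.subset (Set.Finite.union hf hg) (Function.mulSupport_mul _ _)
  inv_mem' := fun hf => Set.Finite.subset hf fun x hx => by
    simp only [Function.mem_mulSupport] at hx ⊢
    simpa using hx

/-- Shift automorphism of the base group: `(c • f) x = f (c⁻¹ * x)`. -/
def wreathShift (A B : Type u) [Group A] [Group B] (c : B) :
    WreathBase A B ≃* WreathBase A B where
  toFun f := ⟨fun x => (f : B → A) (c⁻¹ * x), by
    have hsub : (Function.mulSupport fun x => (f : B → A) (c⁻¹ * x)) ⊆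
        (fun x : B => c * x) '' Function.mulSupport (f : B → A) := by
      intro x hx
      exact ⟨c⁻¹ * x, hx, by simp⟩
    exact (f.2.image _).subset hsub⟩
  invFun f := ⟨fun x => (f : B → A) (c * x), by
    have hsub : (Function.mulSupport fun x => (f : B → A) (c * x)) ⊆
        (fun x : B => c⁻¹ * x) '' Function.mulSupport (f : B → A) := by
      intro x hx
      exact ⟨c * x, hx, by simp⟩
    exact (f.2.image _).subset hsub⟩
  left_inv f := Subtype.ext (funext fun x => by simp)
  right_inv f := Subtype.ext (funext fun x => by simp)
  map_mul' f g := rfl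

/-- The action of `B` on the base group of the wreath product. -/
def wreathAction (A B : Type u) [Group A] [Group B] : B →* MulAut (WreathBase A B) where
  toFun := wreathShift A B
  map_one' := by
    apply MulEquiv.ext
    intro f
    apply Subtype.ext
    funext x
    show (f : B → A) ((1 : B)⁻¹ * x) = (f : B → A) x
    simp
  map_mul' c d := by
    apply MulEquiv.ext
    intro f
    apply Subtype.ext
    funext x
    show (f : B → A) ((c * d)⁻¹ * x) = (f : B → A) (d⁻¹ * (c⁻¹ * x))
    rw [mul_inv_rev, mul_assoc]

/-- The restricted wreath product `A ≀ B`. -/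
abbrev RWreath (A B : Type u) [Group A] [Group B] : Type u :=
  SemidirectProduct (WreathBase A B) B (wreathAction A B)
def rcoset {B : Type u} [Group B] (b x : B) : Set B :=
  {y : B | y * x⁻¹ ∈ Subgroup.zpowers b}

lemma rcoset_mul_left {B : Type u} [Group B] {b c : B}
    (hc : c ∈ Subgroup.centralizer {b}) (y : B) :
    rcoset b (c * y) = (c * ·) '' rcoset b y := by
  have hcomm : b * c = c * b := Subgroup.mem_centralizer_iff.mp hc b rfl
  have hC : Commute b c := hcomm
  ext z
  simp only [rcoset, Set.mem_setOf_eq, Set.mem_image]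
  constructor
  · intro hz
    refine ⟨c⁻¹ * z, ?_, by group⟩
    obtain ⟨k, hk⟩ := Subgroup.mem_zpowers_iff.mp hz
    refine Subgroup.mem_zpowers_iff.mpr ⟨k, ?_⟩
    have hcc : b ^ k * c = c * b ^ k := (hC.zpow_left k).eq
    have hk' : z * y⁻¹ = b ^ k * c := by
      rw [hk]; group
    calc b ^ k = c⁻¹ * (c * b ^ k) := by group
      _ = c⁻¹ * (b ^ k * c) := by rw [hcc]
      _ = c⁻¹ * (z * y⁻¹) := by rw [hk']
      _ = c⁻¹ * z * y⁻¹ := by group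
  · rintro ⟨w, hw, rfl⟩
    obtain ⟨k, hk⟩ := Subgroup.mem_zpowers_iff.mp hw
    refine Subgroup.mem_zpowers_iff.mpr ⟨k, ?_⟩
    have hcc : b ^ k * c = c * b ^ k := (hC.zpow_left k).eq
    calc b ^ k = c * b ^ k * c⁻¹ := by rw [← hcc]; group
      _ = c * (w * y⁻¹) * c⁻¹ := by rw [hk]
      _ = c * w * (c * y)⁻¹ := by group

/-- An element `fb` of `A ≀ B` is reduced if distinct elements of `supp f` lie in
distinct right cosets of `⟨b⟩`. -/
def IsReducedPair {A B : Type u} [Group A] [Group B] (f : WreathBase A B) (b : B) : Prop :=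
  ∀ s ∈ Function.mulSupport (f : B → A), ∀ t ∈ Function.mulSupport (f : B → A),
    t * s⁻¹ ∈ Subgroup.zpowers b → s = t

/-- The set `C_B(f,b) = C⁺_B(f,b) ∩ C_B(b)`. -/
def CBset {A B : Type u} [Group A] [Group B] (f : WreathBase A B) (b : B) : Set B :=
  {c | c ∈ Subgroup.centralizer {b} ∧
    ∀ a : A, a ≠ 1 → a ∈ Set.range (f : B → A) →
      (fun s : B => rcoset b (c * s)) '' ((f : B → A) ⁻¹' {a}) =
        rcoset b '' ((f : B → A) ⁻¹' {a})}

/-- `C_B(f,b)` as a subgroup of `B`. -/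
def CBsubgroup {A B : Type u} [Group A] [Group B] (f : WreathBase A B) (b : B) :
    Subgroup B where
  carrier := CBset f b
  one_mem' := by
    refine ⟨Subgroup.one_mem _, ?_⟩
    intro a _ _
    simp
  mul_mem' := by
    rintro c c' ⟨hc1, hc2⟩ ⟨hc'1, hc'2⟩
    refine ⟨Subgroup.mul_mem _ hc1 hc'1, ?_⟩
    intro a ha har
    calc (fun s : B => rcoset b (c * c' * s)) '' ((f : B → A) ⁻¹' {a})
        = (fun s : B => (c * ·) '' rcoset b (c' * s)) '' ((f : B → A) ⁻¹' {a}) := by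
          have he : (fun s : B => rcoset b (c * c' * s)) =
              fun s : B => (c * ·) '' rcoset b (c' * s) := by
            funext s; rw [mul_assoc, rcoset_mul_left hc1]
          rw [he]
      _ = (fun X : Set B => (c * ·) '' X) ''
            ((fun s : B => rcoset b (c' * s)) '' ((f : B → A) ⁻¹' {a})) := by
          rw [Set.image_image]
      _ = (fun X : Set B => (c * ·) '' X) '' (rcoset b '' ((f : B → A) ⁻¹' {a})) := by
          rw [hc'2 a ha har]
      _ = (fun s : B => (c * ·) '' rcoset b s) '' ((f : B → A) ⁻¹' {a}) := by
          rw [Set.image_image]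
      _ = (fun s : B => rcoset b (c * s)) '' ((f : B → A) ⁻¹' {a}) := by
          have he : (fun s : B => (c * ·) '' rcoset b s) =
              fun s : B => rcoset b (c * s) := by
            funext s; rw [rcoset_mul_left hc1]
          rw [he]
      _ = rcoset b '' ((f : B → A) ⁻¹' {a}) := hc2 a ha har
  inv_mem' := by
    rintro c ⟨hc1, hc2⟩
    have hinv : c⁻¹ ∈ Subgroup.centralizer {b} := Subgroup.inv_mem _ hc1
    refine ⟨hinv, ?_⟩
    intro a ha har
    calc (fun s : B => rcoset b (c⁻¹ * s)) '' ((f : B → A) ⁻¹' {a})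
        = (fun s : B => (c⁻¹ * ·) '' rcoset b s) '' ((f : B → A) ⁻¹' {a}) := by
          have he : (fun s : B => rcoset b (c⁻¹ * s)) =
              fun s : B => (c⁻¹ * ·) '' rcoset b s := by
            funext s; rw [rcoset_mul_left hinv]
          rw [he]
      _ = (fun X : Set B => (c⁻¹ * ·) '' X) '' (rcoset b '' ((f : B → A) ⁻¹' {a})) := by
          rw [Set.image_image]
      _ = (fun X : Set B => (c⁻¹ * ·) '' X) ''
            ((fun s : B => rcoset b (c * s)) '' ((f : B → A) ⁻¹' {a})) := by
          rw [hc2 a ha har]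
      _ = (fun s : B => (c⁻¹ * ·) '' rcoset b (c * s)) '' ((f : B → A) ⁻¹' {a}) := by
          rw [Set.image_image]
      _ = rcoset b '' ((f : B → A) ⁻¹' {a}) := by
          have he : (fun s : B => (c⁻¹ * ·) '' rcoset b (c * s)) =
              fun s : B => rcoset b s := by
            funext s; rw [← rcoset_mul_left hinv, inv_mul_cancel_left]
          rw [he]

/-- The permutation group condition set `Σ(f,b)`. -/
def SigmaSet {A B : Type u} [Group A] [Group B] (f : WreathBase A B) (b : B) :
    Set (Equiv.Perm ↥(Function.mulSupport (f : B → A))) :=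
  {σ | ∀ a : A, a ≠ 1 →
    (fun s : ↥(Function.mulSupport (f : B → A)) => rcoset b ↑(σ s)) ''
        {s : ↥(Function.mulSupport (f : B → A)) | (f : B → A) ↑s = a} =
      (fun s : ↥(Function.mulSupport (f : B → A)) => rcoset b ↑s) ''
        {s : ↥(Function.mulSupport (f : B → A)) | (f : B → A) ↑s = a}}
/-- The generator `a` of the Grigorchuk group: `a(0σ) = 1σ`, `a(1σ) = 0σ`. -/
def grigA : List Bool → List Bool
  | [] => []
  | x :: σ => (!x) :: σ

lemma grigA_involutive : Function.Involutive grigA := by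
  intro σ
  cases σ <;> simp [grigA]

/-- The generators `b`, `c`, `d` of the Grigorchuk group, indexed by `0`, `1`, `2`
respectively: `b = (a, c)`, `c = (a, d)`, `d = (1, b)` (where `false` encodes the
symbol `0` and `true` encodes the symbol `1`). -/
def grigBCD : Fin 3 → List Bool → List Bool
  | _, [] => []
  | i, false :: σ => false :: (if i = 2 then σ else grigA σ)
  | i, true :: σ => true :: grigBCD (i + 1) σ

lemma grigBCD_involutive (i : Fin 3) : Function.Involutive (grigBCD i) := by
  intro σ
  induction σ generalizing i with
  | nil => rfl
  | cons x σ ih =>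
    cases x with
    | false =>
      by_cases h : i = 2 <;> simp [grigBCD, h, grigA_involutive σ]
    | true => simp [grigBCD, ih]

/-- The Grigorchuk group, as the group of permutations of the vertex set `{0,1}*` of the
infinite rooted binary tree generated by `a`, `b`, `c` and `d`. -/
def Grigorchuk : Subgroup (Equiv.Perm (List Bool)) :=
  Subgroup.closure
    {grigA_involutive.toPerm, (grigBCD_involutive 0).toPerm,
      (grigBCD_involutive 1).toPerm, (grigBCD_involutive 2).toPerm}

namespace Grig

abbrev A := Equiv.Perm (List Bool)

def ga : A := grigA_involutive.toPerm
def gb : A := (grigBCD_involutive 0).toPerm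
def gc : A := (grigBCD_involutive 1).toPerm
def gd : A := (grigBCD_involutive 2).toPerm

def prFun (g h : List Bool → List Bool) : List Bool → List Bool
  | [] => []
  | false :: σ => false :: g σ
  | true :: σ => true :: h σ

/-- the automorphism acting by `g` and `h` on the two subtrees -/
def pr (g h : A) : A where
  toFun := prFun g h
  invFun := prFun g.symm h.symm
  left_inv := by
    intro σ
    rcases σ with _ | ⟨_ | _, σ⟩ <;> simp [prFun]
  right_inv := by
    intro σ
    rcases σ with _ | ⟨_ | _, σ⟩ <;> simp [prFun]

lemma pr_nil (g h : A) : pr g h [] = [] := rfl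
lemma pr_false (g h : A) (σ : List Bool) : pr g h (false :: σ) = false :: g σ := rfl
lemma pr_true (g h : A) (σ : List Bool) : pr g h (true :: σ) = true :: h σ := rfl

lemma ext3 {f g : A} (h0 : f [] = g []) (h1 : ∀ σ, f (false :: σ) = g (false :: σ))
    (h2 : ∀ σ, f (true :: σ) = g (true :: σ)) : f = g := by
  apply Equiv.ext
  intro σ
  rcases σ with _ | ⟨_ | _, σ⟩
  · exact h0
  · exact h1 σ
  · exact h2 σ

lemma pr_mul (g h g' h' : A) : pr g h * pr g' h' = pr (g * g') (h * h') := by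
  apply ext3 <;> intros <;> rfl

lemma pr_one : pr 1 1 = 1 := by
  apply ext3 <;> intros <;> rfl

lemma pr_inv (g h : A) : (pr g h)⁻¹ = pr g⁻¹ h⁻¹ := by
  rw [inv_eq_iff_mul_eq_one, pr_mul, mul_inv_cancel, mul_inv_cancel, pr_one]

lemma pr_inj {g h g' h' : A} (e : pr g h = pr g' h') : g = g' ∧ h = h' := by
  constructor
  · apply Equiv.ext
    intro σ
    have := congrArg (fun f : A => f (false :: σ)) e
    simpa [pr_false] using this
  · apply Equiv.ext
    intro σ
    have := congrArg (fun f : A => f (true :: σ)) e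
    simpa [pr_true] using this

lemma ga_pr (g h : A) : ga * pr g h = pr h g * ga := by
  apply ext3 <;> intros <;> rfl

lemma ga_ga : ga * ga = 1 := by
  apply Equiv.ext; intro σ; exact grigA_involutive σ
lemma gb_gb : gb * gb = 1 := by
  apply Equiv.ext; intro σ; exact grigBCD_involutive 0 σ
lemma gc_gc : gc * gc = 1 := by
  apply Equiv.ext; intro σ; exact grigBCD_involutive 1 σ
lemma gd_gd : gd * gd = 1 := by
  apply Equiv.ext; intro σ; exact grigBCD_involutive 2 σ

lemma gb_eq : gb = pr ga gc := by
  apply ext3 <;> intros <;> rfl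
lemma gc_eq : gc = pr ga gd := by
  apply ext3 <;> intros <;> rfl
lemma gd_eq : gd = pr 1 gb := by
  apply ext3 <;> intros <;> rfl

lemma ga_inv : ga⁻¹ = ga := inv_eq_of_mul_eq_one_left ga_ga
lemma gb_inv : gb⁻¹ = gb := inv_eq_of_mul_eq_one_left gb_gb
lemma gc_inv : gc⁻¹ = gc := inv_eq_of_mul_eq_one_left gc_gc
lemma gd_inv : gd⁻¹ = gd := inv_eq_of_mul_eq_one_left gd_gd

lemma pr_ne (g h g' h' : A) : pr g h ≠ pr g' h' * ga := by
  intro e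
  have := congrArg (fun f : A => f [true]) e
  have h2 : (pr g' h' * ga) [true] = false :: g' [] := rfl
  simp [pr_true, h2] at this

lemma bcd_aux (i : Fin 3) (σ : List Bool) :
    grigBCD i (grigBCD (i + 1) σ) = grigBCD (i + 2) σ := by
  induction σ generalizing i with
  | nil => rfl
  | cons x σ ih =>
    cases x with
    | false => fin_cases i <;> simp [grigBCD, grigA_involutive σ]
    | true =>
      have h1 : i + 1 + 1 = i + 2 := by fin_cases i <;> rfl
      have h2 := ih (i + 1)
      have h3 : i + 2 + 1 = i + 1 + 2 := by fin_cases i <;> rfl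
      simp only [grigBCD, h2, h3]

lemma gb_gc : gb * gc = gd := Equiv.ext fun σ => bcd_aux 0 σ
lemma gc_gd : gc * gd = gb := Equiv.ext fun σ => bcd_aux 1 σ
lemma gd_gb : gd * gb = gc := Equiv.ext fun σ => bcd_aux 2 σ
lemma gc_gb : gc * gb = gd := by
  rw [← inv_inj, mul_inv_rev, gb_inv, gc_inv, gd_inv, gb_gc]
lemma gd_gc : gd * gc = gb := by
  rw [← inv_inj, mul_inv_rev, gb_inv, gc_inv, gd_inv, gc_gd]
lemma gb_gd : gb * gd = gc := by
  rw [← inv_inj, mul_inv_rev, gb_inv, gc_inv, gd_inv, gd_gb]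

local notation "Γ" => Grigorchuk

lemma ga_mem : ga ∈ Γ := Subgroup.subset_closure (Or.inl rfl)
lemma gb_mem : gb ∈ Γ := Subgroup.subset_closure (Or.inr (Or.inl rfl))
lemma gc_mem : gc ∈ Γ := Subgroup.subset_closure (Or.inr (Or.inr (Or.inl rfl)))
lemma gd_mem : gd ∈ Γ := Subgroup.subset_closure (Or.inr (Or.inr (Or.inr rfl)))

inductive Sy : Type
  | b : Sy
  | c : Sy
  | d : Sy

def bs : Sy → A
  | .b => gb
  | .c => gc
  | .d => gd

/-- letters: `none` is `a` -/
def lt : Option Sy → A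
  | none => ga
  | some s => bs s

def ev : List (Option Sy) → A
  | [] => 1
  | x :: w => lt x * ev w

lemma ev_append (u v : List (Option Sy)) : ev (u ++ v) = ev u * ev v := by
  induction u with
  | nil => simp [ev]
  | cons x u ih => simp [ev, ih, mul_assoc]

lemma bs_mem (s : Sy) : bs s ∈ Γ := by
  cases s
  · exact gb_mem
  · exact gc_mem
  · exact gd_mem

lemma lt_mem (x : Option Sy) : lt x ∈ Γ := by
  cases x
  · exact ga_mem
  · exact bs_mem _

lemma ev_mem (w : List (Option Sy)) : ev w ∈ Γ := by
  induction w with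
  | nil => exact one_mem _
  | cons x w ih => exact mul_mem (lt_mem x) ih

lemma bs_inv (s : Sy) : (bs s)⁻¹ = bs s := by
  cases s
  · exact gb_inv
  · exact gc_inv
  · exact gd_inv

lemma bs_sq (s : Sy) : bs s * bs s = 1 := by
  cases s
  · exact gb_gb
  · exact gc_gc
  · exact gd_gd

lemma lt_inv (x : Option Sy) : (lt x)⁻¹ = lt x := by
  cases x
  · exact ga_inv
  · exact bs_inv _

lemma exists_ev {g : A} (hg : g ∈ Γ) : ∃ w, ev w = g := by
  induction hg using Subgroup.closure_induction with
  | mem x hx =>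
    rcases hx with rfl | rfl | rfl | rfl
    · exact ⟨[none], by simp [ev, lt]; rfl⟩
    · exact ⟨[some .b], by simp [ev, lt, bs]; rfl⟩
    · exact ⟨[some .c], by simp [ev, lt, bs]; rfl⟩
    · exact ⟨[some .d], by simp [ev, lt, bs]; rfl⟩
  | one => exact ⟨[], rfl⟩
  | mul x y _ _ hx hy =>
    obtain ⟨u, rfl⟩ := hx
    obtain ⟨v, rfl⟩ := hy
    exact ⟨u ++ v, ev_append u v⟩
  | inv x _ hx =>
    obtain ⟨u, rfl⟩ := hx
    refine ⟨u.reverse, ?_⟩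
    induction u with
    | nil => simp [ev]
    | cons x u ih => simp [ev, ev_append, ih (ev_mem u), lt_inv]

/-- induction principle for the group -/
lemma ind {p : A → Prop} (h1 : p 1) (ha : ∀ g ∈ Γ, p g → p (ga * g))
    (hs : ∀ s, ∀ g ∈ Γ, p g → p (bs s * g)) {g : A} (hg : g ∈ Γ) : p g := by
  obtain ⟨w, rfl⟩ := exists_ev hg
  clear hg
  induction w with
  | nil => exact h1
  | cons x w ih =>
    cases x with
    | none => exact ha _ (ev_mem w) ih
    | some s => exact hs s _ (ev_mem w) ih

def s0 : Sy → A
  | .b => ga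
  | .c => ga
  | .d => 1
def s1 : Sy → A
  | .b => gc
  | .c => gd
  | .d => gb

lemma bs_eq (s : Sy) : bs s = pr (s0 s) (s1 s) := by
  cases s
  · exact gb_eq
  · exact gc_eq
  · exact gd_eq

lemma s0_mem (s : Sy) : s0 s ∈ Γ := by
  cases s
  · exact ga_mem
  · exact ga_mem
  · exact one_mem _
lemma s1_mem (s : Sy) : s1 s ∈ Γ := by
  cases s
  · exact gc_mem
  · exact gd_mem
  · exact gb_mem

lemma dec {g : A} (hg : g ∈ Γ) :
    ∃ u v, u ∈ Γ ∧ v ∈ Γ ∧ (g = pr u v ∨ g = pr u v * ga) := by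
  refine ind (p := fun g => ∃ u v, u ∈ Γ ∧ v ∈ Γ ∧ (g = pr u v ∨ g = pr u v * ga))
    ?_ ?_ ?_ hg
  · exact ⟨1, 1, one_mem _, one_mem _, Or.inl pr_one.symm⟩
  · rintro g - ⟨u, v, hu, hv, rfl | rfl⟩
    · exact ⟨v, u, hv, hu, Or.inr (ga_pr _ _)⟩
    · refine ⟨v, u, hv, hu, Or.inl ?_⟩
      rw [← mul_assoc, ga_pr, mul_assoc, ga_ga, mul_one]
  · rintro s g - ⟨u, v, hu, hv, rfl | rfl⟩
    · refine ⟨_, _, mul_mem (s0_mem s) hu, mul_mem (s1_mem s) hv, Or.inl ?_⟩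
      rw [bs_eq, pr_mul]
    · refine ⟨_, _, mul_mem (s0_mem s) hu, mul_mem (s1_mem s) hv, Or.inr ?_⟩
      rw [bs_eq, ← mul_assoc, pr_mul]

lemma mul_ga_ga (x : A) : x * ga * ga = x := by rw [mul_assoc, ga_ga, mul_one]

lemma swap_mem {u v : A} (h : pr u v ∈ Γ) : pr v u ∈ Γ := by
  have : pr v u = ga * pr u v * ga := by rw [ga_pr, mul_ga_ga]
  rw [this]
  exact mul_mem (mul_mem ga_mem h) ga_mem

lemma pr_mem_ga {u v : A} (h : pr u v * ga ∈ Γ) : pr u v ∈ Γ := by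
  rw [← mul_ga_ga (pr u v)]
  exact mul_mem h ga_mem

lemma sec_mem {u v : A} (h : pr u v ∈ Γ) : u ∈ Γ ∧ v ∈ Γ := by
  obtain ⟨u', v', hu, hv, e | e⟩ := dec h
  · obtain ⟨rfl, rfl⟩ := pr_inj e
    exact ⟨hu, hv⟩
  · exact absurd e (pr_ne _ _ _ _)

lemma surj0 {g : A} (hg : g ∈ Γ) : ∃ h, pr g h ∈ Γ := by
  refine ind (p := fun g => ∃ h, pr g h ∈ Γ) ?_ ?_ ?_ hg
  · exact ⟨1, by rw [pr_one]; exact one_mem _⟩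
  · rintro g - ⟨h, hh⟩
    refine ⟨gc * h, ?_⟩
    rw [← pr_mul, ← gb_eq]
    exact mul_mem gb_mem hh
  · rintro s g - ⟨h, hh⟩
    cases s
    · refine ⟨1 * h, ?_⟩
      rw [← pr_mul]
      exact mul_mem (swap_mem (gd_eq ▸ gd_mem)) hh
    · refine ⟨ga * h, ?_⟩
      rw [← pr_mul]
      exact mul_mem (swap_mem (gb_eq ▸ gb_mem)) hh
    · refine ⟨ga * h, ?_⟩
      rw [← pr_mul]
      exact mul_mem (swap_mem (gc_eq ▸ gc_mem)) hh

lemma surj1 {g : A} (hg : g ∈ Γ) : ∃ h, pr h g ∈ Γ :=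
  let ⟨h, hh⟩ := surj0 hg
  ⟨h, swap_mem hh⟩

open scoped commutatorElement

def tt : A := ga * gb * ga * gb

lemma tt_mem : tt ∈ Γ := mul_mem (mul_mem (mul_mem ga_mem gb_mem) ga_mem) gb_mem

lemma tt_eq : tt = pr (gc * ga) (ga * gc) := by
  rw [tt, gb_eq, ga_pr, mul_ga_ga, pr_mul]

lemma pr_one_tt : pr 1 tt = tt * gd * tt⁻¹ * gd⁻¹ := by
  rw [tt_eq, gd_eq, pr_inv, pr_inv, pr_mul, pr_mul, pr_mul, mul_one, mul_inv_cancel,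
    inv_one, mul_one, ← tt_eq, tt]
  congr 1
  rw [mul_inv_rev, gc_inv, ga_inv, gb_inv]
  have : ga * gc * gb * (gc * ga) * gb = ga * (gc * gb * gc) * ga * gb := by
    simp only [mul_assoc]
  rw [this, gc_gb, gd_gc]

def K : Subgroup A := Subgroup.closure {x | ∃ g ∈ Γ, x = g * tt * g⁻¹}

lemma K_conj {g k : A} (hg : g ∈ Γ) (hk : k ∈ K) : g * k * g⁻¹ ∈ K := by
  have : K ≤ K.comap (MulAut.conj g).toMonoidHom := by
    refine (Subgroup.closure_le _).2 ?_
    rintro _ ⟨h, hh, rfl⟩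
    refine Subgroup.subset_closure ⟨g * h, mul_mem hg hh, ?_⟩
    simp [mul_assoc]
  exact this hk

lemma K_le : K ≤ Γ := by
  refine (Subgroup.closure_le _).2 ?_
  rintro _ ⟨h, hh, rfl⟩
  exact mul_mem (mul_mem hh tt_mem) (inv_mem hh)

lemma tt_mem_K : tt ∈ K := Subgroup.subset_closure ⟨1, one_mem _, by simp⟩

/-- second coordinate embedding -/
def in1 : A →* A where
  toFun g := pr 1 g
  map_one' := pr_one
  map_mul' x y := by rw [pr_mul, one_mul]

def in0 : A →* A where
  toFun g := pr g 1
  map_one' := pr_one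
  map_mul' x y := by rw [pr_mul, one_mul]

lemma in0_eq (k : A) : pr k 1 = ga * pr 1 k * ga⁻¹ := by
  rw [ga_pr, ga_inv, mul_ga_ga]

def prHom : A × A →* A where
  toFun p := pr p.1 p.2
  map_one' := pr_one
  map_mul' x y := by rw [pr_mul]; rfl

def Kn : ℕ → Subgroup A
  | 0 => K
  | n + 1 => ((Kn n).prod (Kn n)).map prHom

lemma mem_Kn_succ {n : ℕ} {g : A} :
    g ∈ Kn (n + 1) ↔ ∃ u v, u ∈ Kn n ∧ v ∈ Kn n ∧ g = pr u v := by
  constructor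
  · rintro ⟨⟨u, v⟩, ⟨hu, hv⟩, rfl⟩
    exact ⟨u, v, hu, hv, rfl⟩
  · rintro ⟨u, v, hu, hv, rfl⟩
    exact ⟨⟨u, v⟩, ⟨hu, hv⟩, rfl⟩

lemma pr_mem_Kn {n : ℕ} {u v : A} : pr u v ∈ Kn (n + 1) ↔ u ∈ Kn n ∧ v ∈ Kn n := by
  rw [mem_Kn_succ]
  constructor
  · rintro ⟨u', v', hu, hv, e⟩
    obtain ⟨rfl, rfl⟩ := pr_inj e
    exact ⟨hu, hv⟩
  · rintro ⟨hu, hv⟩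
    exact ⟨u, v, hu, hv, rfl⟩

/-- `K × K` is inside any `Γ`-invariant subgroup containing `(1,t)` -/
lemma KK_le (S : Subgroup A) (hS : ∀ g ∈ Γ, ∀ s ∈ S, g * s * g⁻¹ ∈ S)
    (ht : pr 1 tt ∈ S) : Kn 1 ≤ S := by
  have h1 : K ≤ S.comap in1 := by
    refine (Subgroup.closure_le _).2 ?_
    rintro _ ⟨g, hg, rfl⟩
    obtain ⟨h, hh⟩ := surj1 hg
    have := hS _ hh _ ht
    rw [pr_inv, pr_mul, pr_mul, mul_one, mul_inv_cancel] at this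
    exact this
  intro g hg
  obtain ⟨u, v, hu, hv, rfl⟩ := mem_Kn_succ.1 hg
  have e : pr u v = pr u 1 * pr 1 v := by rw [pr_mul, mul_one, one_mul]
  rw [e]
  refine mul_mem ?_ (h1 hv)
  rw [in0_eq]
  exact hS _ ga_mem _ (h1 hu)

lemma pr_one_tt_mem : pr 1 tt ∈ K := by
  rw [pr_one_tt]
  have : tt * gd * tt⁻¹ * gd⁻¹ = tt * (gd * tt⁻¹ * gd⁻¹) := by simp only [mul_assoc]
  rw [this]
  exact mul_mem tt_mem_K (K_conj gd_mem (inv_mem tt_mem_K))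

lemma Kn_succ_le (n : ℕ) : Kn (n + 1) ≤ Kn n := by
  induction n with
  | zero => exact KK_le K (fun g hg s hs => K_conj hg hs) pr_one_tt_mem
  | succ n ih =>
    intro g hg
    obtain ⟨u, v, hu, hv, rfl⟩ := mem_Kn_succ.1 hg
    exact pr_mem_Kn.2 ⟨ih hu, ih hv⟩

lemma Kn_anti : Antitone Kn := antitone_nat_of_succ_le Kn_succ_le

lemma Kn_le (n : ℕ) : Kn n ≤ Γ := (Kn_anti (Nat.zero_le n)).trans K_le

lemma Kn_conj (n : ℕ) {g k : A} (hg : g ∈ Γ) (hk : k ∈ Kn n) : g * k * g⁻¹ ∈ Kn n := by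
  induction n generalizing g k with
  | zero => exact K_conj hg hk
  | succ n ih =>
    obtain ⟨u, v, hu, hv, rfl⟩ := mem_Kn_succ.1 hk
    obtain ⟨g0, g1, h0, h1, rfl | rfl⟩ := dec hg
    · rw [pr_inv, pr_mul, pr_mul]
      exact pr_mem_Kn.2 ⟨ih h0 hu, ih h1 hv⟩
    · have : pr g0 g1 * ga * pr u v * (pr g0 g1 * ga)⁻¹
          = pr (g0 * v * g0⁻¹) (g1 * u * g1⁻¹) := by
        rw [mul_assoc _ ga, ga_pr, mul_inv_rev, ga_inv]
        have : pr g0 g1 * (pr v u * ga) * (ga * (pr g0 g1)⁻¹)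
          = pr g0 g1 * pr v u * (ga * ga) * (pr g0 g1)⁻¹ := by simp only [mul_assoc]
        rw [this, ga_ga, mul_one, pr_inv, pr_mul, pr_mul]
      rw [this]
      exact pr_mem_Kn.2 ⟨ih h0 hv, ih h1 hu⟩

lemma Kn_conj' (n : ℕ) {g k : A} (hg : g ∈ Γ) (hk : k ∈ Kn n) : g⁻¹ * k * g ∈ Kn n := by
  simpa using Kn_conj n (inv_mem hg) hk

lemma Kn_le_comm (n : ℕ) : Kn (n + 1) ≤ ⁅Kn n, Γ⁆ := by
  have hconj : ∀ n, ∀ g ∈ Γ, ∀ s ∈ ⁅Kn n, Γ⁆, g * s * g⁻¹ ∈ ⁅Kn n, Γ⁆ := by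
    intro n g hg
    have : ⁅Kn n, Γ⁆ ≤ (⁅Kn n, Γ⁆).comap (MulAut.conj g).toMonoidHom := by
      rw [Subgroup.commutator_le]
      intro k hk x hx
      have : (MulAut.conj g).toMonoidHom ⁅k, x⁆ = ⁅g * k * g⁻¹, g * x * g⁻¹⁆ := by
        rw [map_commutatorElement]; rfl
      rw [Subgroup.mem_comap, this]
      exact Subgroup.commutator_mem_commutator (Kn_conj n hg hk)
        (mul_mem (mul_mem hg hx) (inv_mem hg))
    intro s hs
    exact this hs
  induction n with
  | zero =>
    refine KK_le _ (hconj 0) ?_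
    rw [pr_one_tt]
    exact Subgroup.commutator_mem_commutator tt_mem_K gd_mem
  | succ n ih =>
    have h1 : Kn (n + 1) ≤ (⁅Kn (n + 1), Γ⁆).comap in1 := by
      refine ih.trans ?_
      rw [Subgroup.commutator_le]
      intro k hk x hx
      obtain ⟨h, hh⟩ := surj1 hx
      have : in1 ⁅k, x⁆ = ⁅pr 1 k, pr h x⁆ := by
        rw [commutatorElement_def, commutatorElement_def, pr_inv, pr_inv, pr_mul, pr_mul, pr_mul]
        simp [in1]
      rw [Subgroup.mem_comap, this]
      exact Subgroup.commutator_mem_commutator (pr_mem_Kn.2 ⟨one_mem _, hk⟩) hh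
    intro g hg
    obtain ⟨u, v, hu, hv, rfl⟩ := mem_Kn_succ.1 hg
    have e : pr u v = pr u 1 * pr 1 v := by rw [pr_mul, mul_one, one_mul]
    rw [e]
    refine mul_mem ?_ (h1 hv)
    rw [in0_eq]
    exact hconj _ _ ga_mem _ (h1 hu)

/-! ### characters -/

def IsChar (χ : A → ℤˣ) : Prop := ∀ g ∈ Γ, ∀ h ∈ Γ, χ (g * h) = χ g * χ h

lemma IsChar.one {χ : A → ℤˣ} (h : IsChar χ) : χ 1 = 1 := by
  have := h 1 (one_mem _) 1 (one_mem _)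
  simpa using this

lemma IsChar.inv {χ : A → ℤˣ} (h : IsChar χ) {g : A} (hg : g ∈ Γ) : χ g⁻¹ = χ g := by
  have := h g hg g⁻¹ (inv_mem hg)
  rw [mul_inv_cancel, h.one] at this
  rw [← Int.units_inv_eq_self (χ g)]
  exact eq_inv_of_mul_eq_one_right this.symm

lemma IsChar.conj {χ : A → ℤˣ} (h : IsChar χ) {g x : A} (hg : g ∈ Γ) (hx : x ∈ Γ) :
    χ (g * x * g⁻¹) = χ x := by
  rw [h _ (mul_mem hg hx) _ (inv_mem hg), h _ hg _ hx, h.inv hg, mul_comm, ← mul_assoc,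
    Int.units_mul_self, one_mul]

lemma IsChar.K {χ : A → ℤˣ} (h : IsChar χ) {k : A} (hk : k ∈ K) : χ k = 1 := by
  have : k ∈ Γ ∧ χ k = 1 := by
    induction hk using Subgroup.closure_induction with
    | mem x hx =>
      obtain ⟨g, hg, rfl⟩ := hx
      refine ⟨mul_mem (mul_mem hg tt_mem) (inv_mem hg), ?_⟩
      rw [h.conj hg tt_mem, tt, h _ (mul_mem (mul_mem ga_mem gb_mem) ga_mem) _ gb_mem,
        h _ (mul_mem ga_mem gb_mem) _ ga_mem, h _ ga_mem _ gb_mem]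
      have e : χ ga * χ gb * χ ga * χ gb = (χ ga * χ ga) * (χ gb * χ gb) := by
        simp only [mul_comm, mul_left_comm]
      rw [e, Int.units_mul_self, Int.units_mul_self, one_mul]
    | one => exact ⟨one_mem _, h.one⟩
    | mul x y _ _ hx hy =>
      refine ⟨mul_mem hx.1 hy.1, ?_⟩
      rw [h _ hx.1 _ hy.1, hx.2, hy.2, one_mul]
    | inv x _ hx => exact ⟨inv_mem hx.1, by rw [h.inv hx.1, hx.2]⟩
  exact this.2

/-- if `x = y` modulo `K` then characters agree -/
lemma IsChar.congr {χ : A → ℤˣ} (h : IsChar χ) {x y : A} (hx : x ∈ Γ) (hy : y ∈ Γ)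
    (e : x * y⁻¹ ∈ Kn 0) : χ x = χ y := by
  have := h.K e
  rw [h _ hx _ (inv_mem hy), h.inv hy] at this
  rw [← Int.units_inv_eq_self (χ y)]
  exact eq_inv_of_mul_eq_one_left this

open Classical in
noncomputable def lift (χ : A → ℤˣ) (g : A) : ℤˣ :=
  if h : ∃ p : A × A, g = pr p.1 p.2 ∨ g = pr p.1 p.2 * ga then
    χ h.choose.1 * χ h.choose.2 else 1

lemma lift_pr (χ : A → ℤˣ) (u v : A) : lift χ (pr u v) = χ u * χ v := by
  have h : ∃ p : A × A, pr u v = pr p.1 p.2 ∨ pr u v = pr p.1 p.2 * ga := ⟨(u, v), Or.inl rfl⟩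
  rw [lift, dif_pos h]
  rcases h.choose_spec with e | e
  · obtain ⟨e1, e2⟩ := pr_inj e
    rw [← e1, ← e2]
  · exact absurd e (pr_ne _ _ _ _)

lemma lift_ga (χ : A → ℤˣ) (u v : A) : lift χ (pr u v * ga) = χ u * χ v := by
  have h : ∃ p : A × A, pr u v * ga = pr p.1 p.2 ∨ pr u v * ga = pr p.1 p.2 * ga :=
    ⟨(u, v), Or.inr rfl⟩
  rw [lift, dif_pos h]
  rcases h.choose_spec with e | e
  · exact absurd e.symm (pr_ne _ _ _ _)
  · obtain ⟨e1, e2⟩ := pr_inj (mul_right_cancel e)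
    rw [← e1, ← e2]

lemma ga_pr' (x : A) (u v : A) : x * ga * pr u v = x * pr v u * ga := by
  rw [mul_assoc, ga_pr, mul_assoc]

lemma isChar_lift {χ : A → ℤˣ} (h : IsChar χ) : IsChar (lift χ) := by
  intro g hg g' hg'
  obtain ⟨u, v, hu, hv, rfl | rfl⟩ := dec hg <;>
  obtain ⟨u', v', hu', hv', rfl | rfl⟩ := dec hg'
  · rw [pr_mul, lift_pr, lift_pr, lift_pr, h _ hu _ hu', h _ hv _ hv']
    exact mul_mul_mul_comm _ _ _ _
  · rw [← mul_assoc, pr_mul, lift_pr, lift_ga, lift_ga, h _ hu _ hu', h _ hv _ hv']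
    exact mul_mul_mul_comm _ _ _ _
  · rw [ga_pr', pr_mul, lift_pr, lift_ga, lift_ga, h _ hu _ hv', h _ hv _ hu',
      mul_comm (χ u') (χ v')]
    exact mul_mul_mul_comm _ _ _ _
  · rw [← mul_assoc, ga_pr', mul_ga_ga, pr_mul, lift_pr, lift_ga, lift_ga, h _ hu _ hv',
      h _ hv _ hu', mul_comm (χ u') (χ v')]
    exact mul_mul_mul_comm _ _ _ _

noncomputable def χ1 (g : A) : ℤˣ := if g [true] = [true] then 1 else -1

lemma dec_nil {g : A} (hg : g ∈ Γ) : g [] = [] := by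
  obtain ⟨u, v, -, -, rfl | rfl⟩ := dec hg <;> rfl

lemma χ1_pr {u v : A} (hv : v ∈ Γ) : χ1 (pr u v) = 1 := by
  rw [χ1, if_pos]
  rw [pr_true, dec_nil hv]

lemma χ1_ga {u v : A} : χ1 (pr u v * ga) = -1 := by
  rw [χ1, if_neg]
  have h2 : (pr u v * ga) [true] = false :: u [] := rfl
  simp [h2]

lemma isChar1 : IsChar χ1 := by
  intro g hg g' hg'
  obtain ⟨u, v, hu, hv, rfl | rfl⟩ := dec hg <;>
  obtain ⟨u', v', hu', hv', rfl | rfl⟩ := dec hg'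
  · rw [pr_mul, χ1_pr (mul_mem hv hv'), χ1_pr hv, χ1_pr hv', one_mul]
  · rw [← mul_assoc, pr_mul, χ1_pr hv, χ1_ga, χ1_ga, one_mul]
  · rw [ga_pr', pr_mul, χ1_ga, χ1_ga, χ1_pr hv', mul_one]
  · rw [← mul_assoc, ga_pr', mul_ga_ga, pr_mul, χ1_pr (mul_mem hv hu'), χ1_ga, χ1_ga]
    rfl

noncomputable def χ2 : A → ℤˣ := lift χ1
noncomputable def χ3 : A → ℤˣ := lift χ2
lemma isChar2 : IsChar χ2 := isChar_lift isChar1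
lemma isChar3 : IsChar χ3 := isChar_lift isChar2

lemma ga_eq : ga = pr 1 1 * ga := by rw [pr_one, one_mul]

lemma χ1a : χ1 ga = -1 := by rw [ga_eq, χ1_ga]
lemma χ1b : χ1 gb = 1 := by rw [gb_eq, χ1_pr gc_mem]
lemma χ1c : χ1 gc = 1 := by rw [gc_eq, χ1_pr gd_mem]
lemma χ1d : χ1 gd = 1 := by rw [gd_eq, χ1_pr gb_mem]
lemma χ2a : χ2 ga = 1 := by rw [ga_eq, χ2, lift_ga, isChar1.one, one_mul]
lemma χ2b : χ2 gb = -1 := by rw [gb_eq, χ2, lift_pr, χ1a, χ1c, mul_one]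
lemma χ2c : χ2 gc = -1 := by rw [gc_eq, χ2, lift_pr, χ1a, χ1d, mul_one]
lemma χ2d : χ2 gd = 1 := by rw [gd_eq, χ2, lift_pr, isChar1.one, χ1b, mul_one]
lemma χ3a : χ3 ga = 1 := by rw [ga_eq, χ3, lift_ga, isChar2.one, one_mul]
lemma χ3b : χ3 gb = -1 := by rw [gb_eq, χ3, lift_pr, χ2a, χ2c, one_mul]
lemma χ3c : χ3 gc = 1 := by rw [gc_eq, χ3, lift_pr, χ2a, χ2d, one_mul]
lemma χ3d : χ3 gd = -1 := by rw [gd_eq, χ3, lift_pr, isChar2.one, χ2b, one_mul]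

lemma dec_of_χ1 {g : A} (hg : g ∈ Γ) (h : χ1 g = 1) : ∃ u v, u ∈ Γ ∧ v ∈ Γ ∧ g = pr u v := by
  obtain ⟨u, v, hu, hv, e | e⟩ := dec hg
  · exact ⟨u, v, hu, hv, e⟩
  · rw [e, χ1_ga] at h
    exact absurd h (by decide)

lemma dec_of_χ1' {g : A} (hg : g ∈ Γ) (h : χ1 g = -1) :
    ∃ u v, u ∈ Γ ∧ v ∈ Γ ∧ g = pr u v * ga := by
  obtain ⟨u, v, hu, hv, e | e⟩ := dec hg
  · rw [e, χ1_pr hv] at h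
    exact absurd h (by decide)
  · exact ⟨u, v, hu, hv, e⟩

/-- sections of elements of `K` are killed by `χ3` -/
lemma K_sec {k : A} (hk : k ∈ K) : ∃ u v, u ∈ Γ ∧ v ∈ Γ ∧ k = pr u v ∧ χ3 u = 1 ∧ χ3 v = 1 := by
  induction hk using Subgroup.closure_induction with
  | mem x hx =>
    obtain ⟨g, hg, rfl⟩ := hx
    have m1 := mul_mem gc_mem ga_mem
    have m2 := mul_mem ga_mem gc_mem
    have e1 : χ3 (gc * ga) = 1 := by rw [isChar3 _ gc_mem _ ga_mem, χ3a, χ3c, one_mul]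
    have e2 : χ3 (ga * gc) = 1 := by rw [isChar3 _ ga_mem _ gc_mem, χ3a, χ3c, one_mul]
    obtain ⟨u, v, hu, hv, rfl | rfl⟩ := dec hg
    · refine ⟨u * (gc * ga) * u⁻¹, v * (ga * gc) * v⁻¹, mul_mem (mul_mem hu m1) (inv_mem hu),
        mul_mem (mul_mem hv m2) (inv_mem hv), ?_, ?_, ?_⟩
      · rw [tt_eq, pr_inv, pr_mul, pr_mul]
      · rw [isChar3.conj hu m1, e1]
      · rw [isChar3.conj hv m2, e2]
    · refine ⟨u * (ga * gc) * u⁻¹, v * (gc * ga) * v⁻¹, mul_mem (mul_mem hu m2) (inv_mem hu),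
        mul_mem (mul_mem hv m1) (inv_mem hv), ?_, ?_, ?_⟩
      · rw [tt_eq, ga_pr', mul_inv_rev, ga_inv, ← mul_assoc, mul_ga_ga, pr_inv, pr_mul, pr_mul]
      · rw [isChar3.conj hu m2, e2]
      · rw [isChar3.conj hv m1, e1]
  | one => exact ⟨1, 1, one_mem _, one_mem _, pr_one.symm, isChar3.one, isChar3.one⟩
  | mul x y _ _ hx hy =>
    obtain ⟨u, v, hu, hv, rfl, e1, e2⟩ := hx
    obtain ⟨u', v', hu', hv', rfl, e1', e2'⟩ := hy
    refine ⟨u * u', v * v', mul_mem hu hu', mul_mem hv hv', pr_mul _ _ _ _, ?_, ?_⟩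
    · rw [isChar3 _ hu _ hu', e1, e1', one_mul]
    · rw [isChar3 _ hv _ hv', e2, e2', one_mul]
  | inv x _ hx =>
    obtain ⟨u, v, hu, hv, rfl, e1, e2⟩ := hx
    exact ⟨u⁻¹, v⁻¹, inv_mem hu, inv_mem hv, pr_inv _ _, by rw [isChar3.inv hu, e1],
      by rw [isChar3.inv hv, e2]⟩

/-! ### finiteness -/

def pw (i : Bool) (x : A) : A := cond i x 1

lemma pw_comm {x y : A} (h : x * y = y * x) (i : Bool) : x * pw i y = pw i y * x := by
  cases i <;> simp [pw, h]

lemma pw_mem {x : A} (hx : x ∈ Γ) (i : Bool) : pw i x ∈ Γ := by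
  cases i
  · exact one_mem _
  · exact hx

def ge : A := pr gb 1
lemma ge_mem : ge ∈ Γ := swap_mem (gd_eq ▸ gd_mem)
lemma ga_gd : ga * gd = ge * ga := by rw [gd_eq, ga_pr]; rfl
lemma ga_ge : ga * ge = gd * ga := by rw [gd_eq, ge, ga_pr]
lemma gd_ge : gd * ge = ge * gd := by rw [gd_eq, ge, pr_mul, pr_mul]; simp

lemma pw_flip {x : A} (hx : x * x = 1) (i : Bool) : x * pw i x = pw (!i) x := by
  cases i <;> simp [pw, hx]

def rp (i j l m : Bool) : A := pw i gb * (pw j gd * (pw l ge * pw m ga))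

lemma rp_mem (i j l m : Bool) : rp i j l m ∈ Γ :=
  mul_mem (pw_mem gb_mem i) (mul_mem (pw_mem gd_mem j) (mul_mem (pw_mem ge_mem l)
    (pw_mem ga_mem m)))

lemma rp_b (i j l m : Bool) : gb * rp i j l m = rp (!i) j l m := by
  rw [rp, ← mul_assoc, pw_flip gb_gb]; rfl

lemma rp_d (i j l m : Bool) : gd * rp i j l m = rp i (!j) l m := by
  rw [rp, ← mul_assoc, pw_comm (gd_gb.trans gb_gd.symm), mul_assoc, ← mul_assoc gd,
    pw_flip gd_gd]; rfl

lemma rp_a (i j l m : Bool) : ∃ k ∈ K, ga * rp i j l m = rp i l j (!m) * k := by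
  have h1 : ∀ j x, ga * (pw j gd * x) = pw j ge * (ga * x) := by
    intro j x
    cases j
    · simp [pw]
    · simp [pw, ← mul_assoc, ga_gd]
  have h2 : ∀ j x, ga * (pw j ge * x) = pw j gd * (ga * x) := by
    intro j x
    cases j
    · simp [pw]
    · simp [pw, ← mul_assoc, ga_ge]
  have h3 : ∀ j l x, pw j ge * (pw l gd * x) = pw l gd * (pw j ge * x) := by
    intro j l x
    cases j <;> cases l <;> simp [pw, ← mul_assoc, gd_ge]
  have hr : ga * (pw j gd * (pw l ge * pw m ga)) = pw l gd * (pw j ge * pw (!m) ga) := by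
    rw [h1, h2, pw_flip ga_ga, h3]
  cases i
  · refine ⟨1, one_mem _, ?_⟩
    simp only [rp, pw, cond_false, one_mul, mul_one] at hr ⊢
    exact hr
  · set r := pw j gd * (pw l ge * pw m ga) with hrr
    have rm : r ∈ Γ := mul_mem (pw_mem gd_mem j) (mul_mem (pw_mem ge_mem l)
      (pw_mem ga_mem m))
    refine ⟨r⁻¹ * (ga * gb * ga * gb)⁻¹⁻¹ * r, ?_, ?_⟩
    · rw [inv_inv]
      exact Kn_conj' 0 rm tt_mem_K
    · show ga * (gb * r) = gb * (pw l gd * (pw j ge * pw (!m) ga)) * _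
      rw [← hr, inv_inv]
      have : gb * (ga * r) * (r⁻¹ * (ga * gb * ga * gb) * r)
        = gb * (ga * ga) * gb * (ga * (gb * r)) := by group
      rw [this, ga_ga, mul_one, gb_gb, one_mul]

lemma rep {g : A} (hg : g ∈ Γ) : ∃ i j l m, ∃ k ∈ K, g = rp i j l m * k := by
  refine ind (p := fun g => ∃ i j l m, ∃ k ∈ K, g = rp i j l m * k) ?_ ?_ ?_ hg
  · exact ⟨false, false, false, false, 1, one_mem _, by simp [rp, pw]⟩
  · rintro g - ⟨i, j, l, m, k, hk, rfl⟩
    obtain ⟨k', hk', e⟩ := rp_a i j l m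
    exact ⟨i, l, j, !m, k' * k, mul_mem hk' hk, by rw [← mul_assoc, e, mul_assoc]⟩
  · rintro s g - ⟨i, j, l, m, k, hk, rfl⟩
    cases s
    · exact ⟨!i, j, l, m, k, hk, by rw [bs, ← mul_assoc, rp_b]⟩
    · exact ⟨!i, !j, l, m, k, hk, by rw [bs, ← gb_gd, mul_assoc, ← mul_assoc gd, rp_d,
        ← mul_assoc, rp_b]⟩
    · exact ⟨i, !j, l, m, k, hk, by rw [bs, ← mul_assoc, rp_d]⟩

/-- finite colourings distinguishing cosets of `Kn n` -/
lemma colour (n : ℕ) : ∃ (T : Type) (_ : Finite T) (f : A → T),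
    ∀ g ∈ Γ, ∀ h ∈ Γ, f g = f h → g⁻¹ * h ∈ Kn n := by
  induction n with
  | zero =>
    have : ∀ g : A, ∃ p : Bool × Bool × Bool × Bool, g ∈ Γ →
        ∃ k ∈ K, g = rp p.1 p.2.1 p.2.2.1 p.2.2.2 * k := by
      intro g
      by_cases hg : g ∈ Γ
      · obtain ⟨i, j, l, m, hk⟩ := rep hg
        exact ⟨⟨i, j, l, m⟩, fun _ => hk⟩
      · exact ⟨⟨true, true, true, true⟩, fun h => absurd h hg⟩
    choose f hf using this
    refine ⟨_, inferInstance, f, ?_⟩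
    intro g hg h hh e
    obtain ⟨k, hk, e1⟩ := hf g hg
    obtain ⟨k', hk', e2⟩ := hf h hh
    rw [e] at e1
    have : g⁻¹ * h = k⁻¹ * k' := by rw [e2, e1]; group
    rw [this]
    exact mul_mem (inv_mem hk) hk'
  | succ n ih =>
    obtain ⟨T, hT, f, hf⟩ := ih
    have : ∀ g : A, ∃ p : A × A × Bool, g ∈ Γ →
        (p.1 ∈ Γ ∧ p.2.1 ∈ Γ ∧ g = pr p.1 p.2.1 * pw p.2.2 ga) := by
      intro g
      by_cases hg : g ∈ Γ
      · obtain ⟨u, v, hu, hv, e | e⟩ := dec hg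
        · exact ⟨⟨u, v, false⟩, fun _ => ⟨hu, hv, by simpa [pw] using e⟩⟩
        · exact ⟨⟨u, v, true⟩, fun _ => ⟨hu, hv, by simpa [pw] using e⟩⟩
      · exact ⟨⟨1, 1, true⟩, fun h => absurd h hg⟩
    choose F hF using this
    refine ⟨T × T × Bool, inferInstance, fun g => (f (F g).1, f (F g).2.1, (F g).2.2), ?_⟩
    intro g hg h hh e
    obtain ⟨hu, hv, e1⟩ := hF g hg
    obtain ⟨hu', hv', e2⟩ := hF h hh
    simp only [Prod.mk.injEq] at e
    obtain ⟨i1, i2, i3⟩ := e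
    rw [i3] at e1
    have : g⁻¹ * h = (pw (F h).2.2 ga)⁻¹ *
        pr ((F g).1⁻¹ * (F h).1) ((F g).2.1⁻¹ * (F h).2.1) * pw (F h).2.2 ga := by
      rw [← pr_mul, ← pr_inv]
      refine (congrArg₂ (fun x y : A => x⁻¹ * y) e1 e2).trans ?_
      group
    rw [this]
    exact Kn_conj' (n + 1) (pw_mem ga_mem _) (pr_mem_Kn.2 ⟨hf _ hu _ hu' i1, hf _ hv _ hv' i2⟩)

/-- pigeonhole -/
lemma pigeon (m : ℕ) (Q : ℕ → A → Prop) (hQ : ∀ n n' k, n ≤ n' → Q n' k → Q n k)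
    (h : ∀ n, ∃ k ∈ Γ, Q n k) :
    ∃ z ∈ Γ, (∃ n, Q n z) ∧ ∀ n, ∃ k ∈ Γ, z⁻¹ * k ∈ Kn m ∧ Q n k := by
  obtain ⟨T, hT, f, hf⟩ := colour m
  choose k hk hq using h
  obtain ⟨t, ht⟩ := Finite.exists_infinite_fiber (fun n => f (k n))
  rw [Set.infinite_coe_iff] at ht
  obtain ⟨n0, hn0⟩ := ht.nonempty
  refine ⟨k n0, hk n0, ⟨n0, hq n0⟩, fun n => ?_⟩
  obtain ⟨n', hn', hlt⟩ := ht.exists_gt n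
  refine ⟨k n', hk n', hf _ (hk _) _ (hk _) ?_, hQ n n' _ hlt.le (hq n')⟩
  exact hn0.trans hn'.symm

/-! ### approximate conjugacy -/

def RB (n : ℕ) (x y z : A) : Prop :=
  ∀ m, ∃ k ∈ Γ, z⁻¹ * k ∈ Kn n ∧ k * x * k⁻¹ * y⁻¹ ∈ Kn m

def RR (n : ℕ) (x y z : A) : Prop :=
  ∃ k ∈ Γ, z⁻¹ * k ∈ Kn n ∧ k * x * k⁻¹ = y

def P (n : ℕ) (x y : A) : Prop := ∀ z ∈ Γ, RB n x y z → RR n x y z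

lemma RB_shift {n : ℕ} {x y z g : A} (hg : g ∈ Γ) (h : RB n x y (z * g)) :
    RB n (g * x * g⁻¹) y z := by
  intro m
  obtain ⟨k, hk, h1, h2⟩ := h m
  refine ⟨k * g⁻¹, mul_mem hk (inv_mem hg), ?_, ?_⟩
  · have := Kn_conj n hg h1
    convert this using 1
    group
  · convert h2 using 1
    group

lemma RR_shift {n : ℕ} {x y z g : A} (hg : g ∈ Γ) (h : RR n (g * x * g⁻¹) y z) :
    RR n x y (z * g) := by
  obtain ⟨k, hk, h1, h2⟩ := h
  refine ⟨k * g, mul_mem hk hg, ?_, ?_⟩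
  · have := Kn_conj' n hg h1
    convert this using 1
    group
  · rw [← h2]
    group

lemma P_conj_left {n : ℕ} {x y g : A} (hg : g ∈ Γ) (h : P n (g * x * g⁻¹) y) : P n x y := by
  intro z hz hb
  have := RR_shift hg (h (z * g⁻¹) (mul_mem hz (inv_mem hg))
    (RB_shift hg (by simpa using hb)))
  simpa using this

lemma P_conj_right {n : ℕ} {x y g : A} (hg : g ∈ Γ) (h : P n x (g * y * g⁻¹)) : P n x y := by
  intro z hz hb
  have : RR n x (g * y * g⁻¹) (g * z) := by
    refine h _ (mul_mem hg hz) fun m => ?_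
    obtain ⟨k, hk, h1, h2⟩ := hb m
    refine ⟨g * k, mul_mem hg hk, ?_, ?_⟩
    · convert h1 using 1
      group
    · have := Kn_conj m hg h2
      convert this using 1
      group
  obtain ⟨k, hk, h1, h2⟩ := this
  refine ⟨g⁻¹ * k, mul_mem (inv_mem hg) hk, ?_, ?_⟩
  · convert h1 using 1
    group
  · have : g⁻¹ * k * x * (g⁻¹ * k)⁻¹ = g⁻¹ * (k * x * k⁻¹) * g := by group
    rw [this, h2]
    group

lemma coset_sec {n : ℕ} {z0 z1 k : A} (h : (pr z0 z1)⁻¹ * k ∈ Kn (n + 1)) :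
    ∃ k0 k1, k = pr k0 k1 ∧ z0⁻¹ * k0 ∈ Kn n ∧ z1⁻¹ * k1 ∈ Kn n := by
  obtain ⟨u, v, hu, hv, e⟩ := mem_Kn_succ.1 h
  refine ⟨z0 * u, z1 * v, ?_, by simpa using hu, by simpa using hv⟩
  rw [← pr_mul, ← e]
  group

lemma mem_of_coset {n : ℕ} {z k : A} (hz : z ∈ Γ) (h : z⁻¹ * k ∈ Kn n) : k ∈ Γ := by
  have := mul_mem hz (Kn_le n h)
  simpa using this

lemma step_st {n : ℕ} {x0 x1 y0 y1 z0 z1 : A} (hz : pr z0 z1 ∈ Γ)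
    (h0 : P n x0 y0) (h1 : P n x1 y1)
    (h : RB (n + 1) (pr x0 x1) (pr y0 y1) (pr z0 z1)) :
    RR (n + 1) (pr x0 x1) (pr y0 y1) (pr z0 z1) := by
  have hz' := sec_mem hz
  have key : ∀ m, ∃ k0 k1, k0 ∈ Γ ∧ k1 ∈ Γ ∧ z0⁻¹ * k0 ∈ Kn n ∧ z1⁻¹ * k1 ∈ Kn n ∧
      k0 * x0 * k0⁻¹ * y0⁻¹ ∈ Kn m ∧ k1 * x1 * k1⁻¹ * y1⁻¹ ∈ Kn m := by
    intro m
    obtain ⟨k, hk, a1, a2⟩ := h (m + 1)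
    obtain ⟨k0, k1, rfl, b0, b1⟩ := coset_sec a1
    rw [pr_inv, pr_inv, pr_mul, pr_mul, pr_mul, pr_mem_Kn] at a2
    exact ⟨k0, k1, mem_of_coset hz'.1 b0, mem_of_coset hz'.2 b1, b0, b1, a2.1, a2.2⟩
  obtain ⟨k0, hk0, a0, c0⟩ := h0 z0 hz'.1 (fun m => by
    obtain ⟨k0, k1, m0, m1, b0, b1, d0, d1⟩ := key m
    exact ⟨k0, m0, b0, d0⟩)
  obtain ⟨k1, hk1, a1, c1⟩ := h1 z1 hz'.2 (fun m => by
    obtain ⟨k0, k1, m0, m1, b0, b1, d0, d1⟩ := key m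
    exact ⟨k1, m1, b1, d1⟩)
  have hm : (pr z0 z1)⁻¹ * pr k0 k1 ∈ Kn (n + 1) := by
    rw [pr_inv, pr_mul]
    exact pr_mem_Kn.2 ⟨a0, a1⟩
  refine ⟨pr k0 k1, mem_of_coset hz hm, hm, ?_⟩
  rw [pr_inv, pr_mul, pr_mul, c0, c1]

lemma sw_conj (k0 k1 x0 x1 : A) : pr k0 k1 * (pr x0 x1 * ga) * (pr k0 k1)⁻¹
    = pr (k0 * x0 * k1⁻¹) (k1 * x1 * k0⁻¹) * ga := by
  rw [pr_inv, ← mul_assoc, pr_mul, ga_pr', pr_mul]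

lemma sw_div (u v u' v' : A) : pr u v * ga * (pr u' v' * ga)⁻¹ = pr (u * u'⁻¹) (v * v'⁻¹) := by
  rw [mul_inv_rev, ga_inv, ← mul_assoc, mul_ga_ga, pr_inv, pr_mul]

lemma step_sw {n : ℕ} {x0 x1 y0 y1 z0 z1 : A} (hz : pr z0 z1 ∈ Γ)
    (hx0 : x0 ∈ Γ) (hy0 : y0 ∈ Γ) (h0 : P n (x0 * x1) (y0 * y1))
    (h : RB (n + 1) (pr x0 x1 * ga) (pr y0 y1 * ga) (pr z0 z1)) :
    RR (n + 1) (pr x0 x1 * ga) (pr y0 y1 * ga) (pr z0 z1) := by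
  have hz' := sec_mem hz
  have key : ∀ m, ∃ k0 k1, k0 ∈ Γ ∧ k1 ∈ Γ ∧ z0⁻¹ * k0 ∈ Kn n ∧ z1⁻¹ * k1 ∈ Kn n ∧
      k0 * x0 * k1⁻¹ * y0⁻¹ ∈ Kn m ∧ k1 * x1 * k0⁻¹ * y1⁻¹ ∈ Kn m := by
    intro m
    obtain ⟨k, hk, a1, a2⟩ := h (m + 1)
    obtain ⟨k0, k1, rfl, b0, b1⟩ := coset_sec a1
    rw [sw_conj, sw_div, pr_mem_Kn] at a2
    exact ⟨k0, k1, mem_of_coset hz'.1 b0, mem_of_coset hz'.2 b1, b0, b1, a2.1, a2.2⟩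
  obtain ⟨k0, hk0, a0, c0⟩ := h0 z0 hz'.1 (fun m => by
    obtain ⟨k0, k1, m0, m1, b0, b1, d0, d1⟩ := key m
    refine ⟨k0, m0, b0, ?_⟩
    have := mul_mem d0 (Kn_conj m hy0 d1)
    convert this using 1
    group)
  have hk1 : z1⁻¹ * (y0⁻¹ * k0 * x0) ∈ Kn n := by
    obtain ⟨l0, l1, m0, m1, b0, b1, d0, d1⟩ := key n
    have e1 : l0⁻¹ * k0 ∈ Kn n := by
      have := mul_mem (inv_mem b0) a0
      convert this using 1
      group
    have e2 : l1⁻¹ * (y0⁻¹ * l0 * x0) ∈ Kn n := by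
      have := Kn_conj' n m1 (Kn_conj' n hy0 d0)
      convert this using 1
      group
    have e3 := mul_mem (mul_mem b1 e2) (Kn_conj' n hx0 e1)
    convert e3 using 1
    group
  have hm : (pr z0 z1)⁻¹ * pr k0 (y0⁻¹ * k0 * x0) ∈ Kn (n + 1) := by
    rw [pr_inv, pr_mul]
    exact pr_mem_Kn.2 ⟨a0, hk1⟩
  refine ⟨_, mem_of_coset hz hm, hm, ?_⟩
  rw [sw_conj]
  congr 2
  · group
  · have : y0⁻¹ * k0 * x0 * x1 * k0⁻¹ = y0⁻¹ * (k0 * (x0 * x1) * k0⁻¹) := by group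
    rw [this, c0]
    group

lemma P_succ_st {n : ℕ} {x0 x1 y0 y1 : A} (h00 : P n x0 y0) (h11 : P n x1 y1)
    (h01 : P n x0 y1) (h10 : P n x1 y0) : P (n + 1) (pr x0 x1) (pr y0 y1) := by
  intro z hz hb
  obtain ⟨z0, z1, _, _, rfl | rfl⟩ := dec hz
  · exact step_st hz h00 h11 hb
  · have e : ga * pr x0 x1 * ga⁻¹ = pr x1 x0 := by rw [ga_pr, ga_inv, mul_ga_ga]
    apply RR_shift ga_mem
    have := RB_shift ga_mem hb
    rw [e] at this ⊢
    exact step_st (pr_mem_ga hz) h10 h01 this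

lemma P_succ_sw {n : ℕ} {x0 x1 y0 y1 : A} (hx0 : x0 ∈ Γ) (hx1 : x1 ∈ Γ) (hy0 : y0 ∈ Γ)
    (h : P n (x0 * x1) (y0 * y1)) : P (n + 1) (pr x0 x1 * ga) (pr y0 y1 * ga) := by
  intro z hz hb
  obtain ⟨z0, z1, _, _, rfl | rfl⟩ := dec hz
  · exact step_sw hz hx0 hy0 h hb
  · have e : ga * (pr x0 x1 * ga) * ga⁻¹ = pr x1 x0 * ga := by
      rw [← mul_assoc, ga_pr, ga_inv, mul_ga_ga]
    apply RR_shift ga_mem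
    have := RB_shift ga_mem hb
    rw [e] at this ⊢
    refine step_sw (pr_mem_ga hz) hx1 hy0 ?_ this
    apply P_conj_left hx0
    have e2 : x0 * (x1 * x0) * x0⁻¹ = x0 * x1 := by group
    rw [e2]
    exact h

lemma RB_char {n : ℕ} {x y z : A} (hx : x ∈ Γ) (hy : y ∈ Γ) (h : RB n x y z)
    {χ : A → ℤˣ} (hχ : IsChar χ) : χ x = χ y := by
  obtain ⟨k, hk, -, h2⟩ := h 0
  rw [← hχ.conj hk hx]
  exact hχ.congr (mul_mem (mul_mem hk hx) (inv_mem hk)) hy h2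

lemma P_of_ne {n : ℕ} {x y : A} (hx : x ∈ Γ) (hy : y ∈ Γ) {χ : A → ℤˣ} (hχ : IsChar χ)
    (h : χ x ≠ χ y) : P n x y :=
  fun _ _ hb => absurd (RB_char hx hy hb hχ) h

lemma P_desc {n : ℕ} {x y : A} (h : P (n + 1) x y) : P n x y := by
  intro z hz hb
  obtain ⟨z', hz', ⟨-, a1, -⟩, h2⟩ := pigeon (n + 1)
    (fun m k => z⁻¹ * k ∈ Kn n ∧ k * x * k⁻¹ * y⁻¹ ∈ Kn m)
    (fun m m' k hm hk => ⟨hk.1, Kn_anti hm hk.2⟩) hb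
  obtain ⟨k, hk, b1, b2⟩ := h z' hz' (fun m => by
    obtain ⟨k, hk, c1, c2, c3⟩ := h2 m
    exact ⟨k, hk, c1, c3⟩)
  refine ⟨k, hk, ?_, b2⟩
  have := mul_mem a1 (Kn_succ_le n b1)
  convert this using 1
  group

/-! ### base cases -/

lemma P_one (n : ℕ) : P n 1 1 := by
  intro z hz _
  exact ⟨z, hz, by simp [one_mem], by simp⟩

lemma P_a : P 0 ga ga := by
  apply P_desc
  rw [ga_eq]
  refine P_succ_sw (one_mem _) (one_mem _) (one_mem _) ?_
  rw [one_mul]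
  exact P_one 0

lemma RR_of_rep {x z r k : A} (hr : r ∈ Γ) (hk : k ∈ K) (e : z = r * k) (hc : r * x = x * r) :
    RR 0 x x z := by
  refine ⟨r, hr, ?_, by rw [hc]; group⟩
  rw [e]
  have : (r * k)⁻¹ * r = k⁻¹ := by group
  rw [this]
  exact inv_mem hk

lemma comm_pw {x y : A} (h : x * y = y * x) (i : Bool) : pw i y * x = x * pw i y :=
  (pw_comm h i).symm

lemma χ1_coset {z k : A} (hz : z ∈ Γ) (hk : k ∈ Γ) (h : z⁻¹ * k ∈ Kn 0) : χ1 k = χ1 z := by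
  have := isChar1.K h
  rw [isChar1 _ (inv_mem hz) _ hk, isChar1.inv hz] at this
  rw [← Int.units_inv_eq_self (χ1 z)]
  exact eq_inv_of_mul_eq_one_right this

lemma units_cases (u : ℤˣ) : u = 1 ∨ u = -1 := Int.units_eq_one_or u

lemma sw_conj' (k0 k1 x0 x1 : A) : pr k0 k1 * ga * pr x0 x1 * (pr k0 k1 * ga)⁻¹
    = pr (k0 * x1 * k0⁻¹) (k1 * x0 * k1⁻¹) := by
  rw [ga_pr', pr_mul, sw_div]

lemma χ1_rp (i j l m : Bool) {k : A} (hk : k ∈ K) : χ1 (rp i j l m * k) = cond m (-1) 1 := by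
  have he : χ1 ge = 1 := χ1_pr (one_mem _)
  rw [isChar1 _ (rp_mem _ _ _ _) _ (K_le hk), isChar1.K hk, mul_one, rp]
  rw [isChar1 _ (pw_mem gb_mem i) _ (mul_mem (pw_mem gd_mem j) (mul_mem (pw_mem ge_mem l)
    (pw_mem ga_mem m))), isChar1 _ (pw_mem gd_mem j) _ (mul_mem (pw_mem ge_mem l)
    (pw_mem ga_mem m)), isChar1 _ (pw_mem ge_mem l) _ (pw_mem ga_mem m)]
  cases i <;> cases j <;> cases l <;> cases m <;>
    simp [pw, χ1b, χ1d, χ1a, he, isChar1.one]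

lemma P_d : P 0 gd gd := by
  intro z hz hb
  obtain ⟨i, j, l, m, k, hk, e⟩ := rep hz
  cases m with
  | false =>
    refine RR_of_rep (rp_mem i j l false) hk e ?_
    have h1 := comm_pw (gd_gb.trans gb_gd.symm) i
    have h2 := comm_pw (x := gd) (y := gd) rfl j
    have h3 := comm_pw gd_ge l
    have h4 : pw false ga * gd = gd * pw false ga := by simp [pw]
    rw [rp]
    exact (Commute.mul_left h1 (Commute.mul_left h2 (Commute.mul_left h3 h4)))
  | true =>
    exfalso
    obtain ⟨k', hk', a1, a2⟩ := hb 1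
    have h1 := χ1_coset hz hk' a1
    rw [e, χ1_rp i j l true hk] at h1
    obtain ⟨u, v, hu, hv, rfl⟩ := dec_of_χ1' hk' h1
    rw [gd_eq, sw_conj', pr_inv, pr_mul, pr_mem_Kn] at a2
    have := isChar2.K a2.2
    rw [mul_one, mul_inv_cancel, one_mul, isChar2.inv gb_mem, χ2b] at this
    exact absurd this (by decide)

/-- an element commuting with `a` modulo `K × K` is killed by `χ3` -/
lemma χ3_cent {k : A} (hk : k ∈ Γ) (h : k * ga * k⁻¹ * ga⁻¹ ∈ Kn 1) : χ3 k = 1 := by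
  have fin : ∀ u v, u ∈ Γ → v ∈ Γ → pr (u * v⁻¹) (v * u⁻¹) ∈ Kn 1 → χ2 u * χ2 v = 1 := by
    intro u v hu hv h
    have := isChar2.congr hu hv (pr_mem_Kn.1 h).1
    rw [this, Int.units_mul_self]
  have e0 : ∀ u v, pr u v * ga * (pr u v)⁻¹ * ga⁻¹ = pr (u * v⁻¹) (v * u⁻¹) := by
    intro u v
    rw [pr_inv, ga_pr', ga_inv, mul_ga_ga, pr_mul]
  obtain ⟨u, v, hu, hv, rfl | rfl⟩ := dec hk
  · rw [χ3, lift_pr]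
    rw [e0] at h
    exact fin u v hu hv h
  · rw [χ3, lift_ga]
    apply fin u v hu hv
    rw [← e0]
    convert h using 1
    group

lemma P_bc {x y : A} (hy : y ∈ Γ) (hx : x = pr ga y) (hy1 : χ1 y = 1)
    (hb' : gb * x = x * gb) (hd' : gd * x = x * gd) : P 0 x x := by
  intro z hz hb
  obtain ⟨i, j, l, m, k, hk, e⟩ := rep hz
  cases m with
  | true =>
    exfalso
    obtain ⟨k', hk', a1, a2⟩ := hb 1
    have h1 := χ1_coset hz hk' a1
    rw [e, χ1_rp i j l true hk] at h1
    obtain ⟨u, v, hu, hv, rfl⟩ := dec_of_χ1' hk' h1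
    rw [hx, sw_conj', pr_inv, pr_mul, pr_mem_Kn] at a2
    have := isChar1.congr (mul_mem (mul_mem hu hy) (inv_mem hu)) ga_mem a2.1
    rw [isChar1.conj hu hy, hy1, χ1a] at this
    exact absurd this (by decide)
  | false =>
    cases l with
    | false =>
      refine RR_of_rep (rp_mem i j false false) hk e ?_
      have h1 := comm_pw hb'.symm i
      have h2 := comm_pw hd'.symm j
      have h4 : pw false ge * pw false ga * x = x * (pw false ge * pw false ga) := by simp [pw]
      rw [rp]
      exact (Commute.mul_left h1 (Commute.mul_left h2 h4))
    | true =>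
      exfalso
      obtain ⟨k', hk', a1, a2⟩ := hb 2
      have e2 : k' = rp i j true false * (k * (z⁻¹ * k')) := by
        rw [← mul_assoc, ← e]; group
      obtain ⟨u, v, hu, hv, e3, h3, -⟩ := K_sec (mul_mem hk a1)
      rw [e3] at e2
      have e4 : rp i j true false = pr (pw i ga * gb) (pw i gc * pw j gb) := by
        have f1 : pw i gb = pr (pw i ga) (pw i gc) := by
          cases i
          · simp [pw, pr_one]
          · exact gb_eq
        have f2 : pw j gd = pr 1 (pw j gb) := by
          cases j
          · simp [pw, pr_one]
          · exact gd_eq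
        rw [rp, f1, f2]
        simp only [pw, cond_true, cond_false, mul_one]
        rw [ge, pr_mul, pr_mul, one_mul, mul_one]
      rw [e4, pr_mul] at e2
      rw [e2, hx, pr_inv, pr_inv, pr_mul, pr_mul, pr_mul, pr_mem_Kn] at a2
      have m1 := mul_mem (pw_mem ga_mem i) gb_mem
      have := χ3_cent (mul_mem m1 hu) a2.1
      rw [isChar3 _ m1 _ hu, h3, isChar3 _ (pw_mem ga_mem i) _ gb_mem, χ3b] at this
      have f : χ3 (pw i ga) = 1 := by
        cases i
        · exact isChar3.one
        · exact χ3a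
      rw [f] at this
      exact absurd this (by decide)

lemma P_b : P 0 gb gb :=
  P_bc gc_mem gb_eq χ1c rfl (gd_gb.trans gb_gd.symm)
lemma P_c : P 0 gc gc :=
  P_bc gd_mem gc_eq χ1d (gb_gc.trans gc_gb.symm) (gd_gc.trans gc_gd.symm)

def Base (x : A) : Prop := x = 1 ∨ x = ga ∨ x = gb ∨ x = gc ∨ x = gd

lemma P_base {x y : A} (hx : Base x) (hy : Base y) : P 0 x y := by
  have o := one_mem Γ
  have ma := ga_mem
  have mb := gb_mem
  have mc := gc_mem
  have md := gd_mem
  have v1 := isChar1.one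
  have v2 := isChar2.one
  have v3 := isChar3.one
  rcases hx with rfl | rfl | rfl | rfl | rfl <;> rcases hy with rfl | rfl | rfl | rfl | rfl <;>
    first
    | exact P_one 0
    | exact P_a
    | exact P_b
    | exact P_c
    | exact P_d
    | (refine P_of_ne (by assumption) (by assumption) isChar1 ?_
       simp only [v1, χ1a, χ1b, χ1c, χ1d]; decide)
    | (refine P_of_ne (by assumption) (by assumption) isChar2 ?_
       simp only [v2, χ2a, χ2b, χ2c, χ2d]; decide)
    | (refine P_of_ne (by assumption) (by assumption) isChar3 ?_
       simp only [v3, χ3a, χ3b, χ3c, χ3d]; decide)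


/-! ### contraction -/

def D : ℕ → A → Prop
  | 0, x => ∃ g ∈ Γ, Base (g * x * g⁻¹)
  | n + 1, x => ∃ g ∈ Γ, ∃ x0 ∈ Γ, ∃ x1 ∈ Γ,
      (g * x * g⁻¹ = pr x0 x1 ∧ D n x0 ∧ D n x1) ∨
      (g * x * g⁻¹ = pr x0 x1 * ga ∧ D n (x0 * x1))

lemma D_base {x : A} (h : Base x) : D 0 x := ⟨1, one_mem _, by simpa using h⟩

lemma D_succ {n : ℕ} {x : A} (h : D n x) : D (n + 1) x := by
  induction n generalizing x with
  | zero =>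
    obtain ⟨g, hg, h⟩ := h
    refine ⟨g, hg, ?_⟩
    have b1 : D 0 1 := D_base (Or.inl rfl)
    have ba : D 0 ga := D_base (Or.inr (Or.inl rfl))
    have bb : D 0 gb := D_base (Or.inr (Or.inr (Or.inl rfl)))
    have bc : D 0 gc := D_base (Or.inr (Or.inr (Or.inr (Or.inl rfl))))
    have bd : D 0 gd := D_base (Or.inr (Or.inr (Or.inr (Or.inr rfl))))
    rcases h with h | h | h | h | h
    · exact ⟨1, one_mem _, 1, one_mem _, Or.inl ⟨h.trans pr_one.symm, b1, b1⟩⟩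
    · exact ⟨1, one_mem _, 1, one_mem _, Or.inr ⟨h.trans ga_eq, by rw [one_mul]; exact b1⟩⟩
    · exact ⟨ga, ga_mem, gc, gc_mem, Or.inl ⟨h.trans gb_eq, ba, bc⟩⟩
    · exact ⟨ga, ga_mem, gd, gd_mem, Or.inl ⟨h.trans gc_eq, ba, bd⟩⟩
    · exact ⟨1, one_mem _, gb, gb_mem, Or.inl ⟨h.trans gd_eq, b1, bb⟩⟩
  | succ n ih =>
    obtain ⟨g, hg, x0, h0, x1, h1, ⟨e, d0, d1⟩ | ⟨e, d⟩⟩ := h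
    · exact ⟨g, hg, x0, h0, x1, h1, Or.inl ⟨e, ih d0, ih d1⟩⟩
    · exact ⟨g, hg, x0, h0, x1, h1, Or.inr ⟨e, ih d⟩⟩

lemma D_mono {n m : ℕ} (h : n ≤ m) {x : A} (hx : D n x) : D m x := by
  induction h with
  | refl => exact hx
  | step _ ih => exact D_succ ih

lemma D_conj {n : ℕ} {x g : A} (hg : g ∈ Γ) (h : D n (g * x * g⁻¹)) : D n x := by
  have e : ∀ k, k * (g * x * g⁻¹) * k⁻¹ = (k * g) * x * (k * g)⁻¹ := by
    intro k; group
  cases n with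
  | zero =>
    obtain ⟨k, hk, h⟩ := h
    exact ⟨k * g, mul_mem hk hg, by rw [← e]; exact h⟩
  | succ n =>
    obtain ⟨k, hk, h⟩ := h
    exact ⟨k * g, mul_mem hk hg, by rw [← e]; exact h⟩

def ws : Sy → ℕ
  | .b => 4
  | .c => 3
  | .d => 2

def wl : Option Sy → ℕ
  | none => 3
  | some s => ws s

def ww (w : List (Option Sy)) : ℕ := (w.map wl).sum

def S : List Sy → A
  | [] => 1
  | x :: L => bs x * ga * S L

def sw (L : List Sy) : ℕ := (L.map (fun s => ws s + 3)).sum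

lemma S_append (L M : List Sy) : S (L ++ M) = S L * S M := by
  induction L with
  | nil => simp [S]
  | cons x L ih => simp [S, ih, mul_assoc]

lemma sw_append (L M : List Sy) : sw (L ++ M) = sw L + sw M := by
  simp [sw]

lemma sw_cons (x : Sy) (L : List Sy) : sw (x :: L) = ws x + 3 + sw L := by
  simp [sw]

lemma merge (x y : Sy) : bs x * bs y = 1 ∨ ∃ z, bs x * bs y = bs z ∧ ws z ≤ ws x + ws y := by
  cases x <;> cases y
  · exact Or.inl gb_gb
  · exact Or.inr ⟨.d, gb_gc, by decide⟩
  · exact Or.inr ⟨.c, gb_gd, by decide⟩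
  · exact Or.inr ⟨.d, gc_gb, by decide⟩
  · exact Or.inl gc_gc
  · exact Or.inr ⟨.b, gc_gd, by decide⟩
  · exact Or.inr ⟨.c, gd_gb, by decide⟩
  · exact Or.inr ⟨.b, gd_gc, by decide⟩
  · exact Or.inl gd_gd

def oq : Option Sy → A
  | none => 1
  | some s => bs s

def wq : Option Sy → ℕ
  | none => 0
  | some s => ws s

lemma merge_q (x : Sy) (q : Option Sy) : ∃ q', bs x * oq q = oq q' ∧ wq q' ≤ ws x + wq q := by
  cases q with
  | none => exact ⟨some x, by simp [oq], by simp [wq]⟩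
  | some y =>
    rcases merge x y with h | ⟨z, h, hz⟩
    · exact ⟨none, h, by simp [wq]⟩
    · exact ⟨some z, h, hz⟩

lemma nf (w : List (Option Sy)) : ∃ L q,
    (ev w = S L * oq q ∧ sw L + wq q ≤ ww w) ∨
    (ev w = ga * (S L * oq q) ∧ 3 + sw L + wq q ≤ ww w) := by
  induction w with
  | nil => exact ⟨[], none, Or.inl ⟨by simp [ev, S, oq], by simp [sw, wq]⟩⟩
  | cons x w ih =>
    obtain ⟨L, q, ⟨e, h⟩ | ⟨e, h⟩⟩ := ih
    · cases x with
      | none =>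
        refine ⟨L, q, Or.inr ⟨by rw [ev, e, lt], ?_⟩⟩
        simp only [ww, List.map_cons, List.sum_cons, wl] at h ⊢
        omega
      | some x =>
        cases L with
        | nil =>
          obtain ⟨q', e', h'⟩ := merge_q x q
          refine ⟨[], q', Or.inl ⟨by rw [ev, e, lt, S, one_mul, one_mul, e'], ?_⟩⟩
          simp only [ww, List.map_cons, List.sum_cons, wl] at h ⊢
          omega
        | cons y L =>
          rw [sw_cons] at h
          rcases merge x y with h' | ⟨z, h', hz⟩
          · refine ⟨L, q, Or.inr ⟨?_, ?_⟩⟩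
            · rw [ev, e, lt, S]
              simp only [← mul_assoc]
              rw [h', one_mul]
            · simp only [ww, List.map_cons, List.sum_cons, wl] at h ⊢
              omega
          · refine ⟨z :: L, q, Or.inl ⟨?_, ?_⟩⟩
            · rw [ev, e, lt, S, S]
              simp only [← mul_assoc]
              rw [h']
            · rw [sw_cons]
              simp only [ww, List.map_cons, List.sum_cons, wl] at h ⊢
              omega
    · cases x with
      | none =>
        refine ⟨L, q, Or.inl ⟨by rw [ev, e, lt, ← mul_assoc, ga_ga, one_mul], ?_⟩⟩
        simp only [ww, List.map_cons, List.sum_cons, wl] at h ⊢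
        omega
      | some x =>
        refine ⟨x :: L, q, Or.inl ⟨by rw [ev, e, lt, S]; simp only [mul_assoc], ?_⟩⟩
        rw [sw_cons]
        simp only [ww, List.map_cons, List.sum_cons, wl] at h ⊢
        omega

/-- conjugate to a generator or to a cyclically reduced word -/
def C (g : A) (n : ℕ) : Prop := ∃ k ∈ Γ, Base (k * g * k⁻¹) ∨
  ∃ L, L ≠ [] ∧ k * g * k⁻¹ = S L ∧ sw L ≤ n

lemma C_conj {g k : A} {n : ℕ} (hk : k ∈ Γ) (h : C (k * g * k⁻¹) n) : C g n := by
  obtain ⟨l, hl, h⟩ := h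
  refine ⟨l * k, mul_mem hl hk, ?_⟩
  have e : (l * k) * g * (l * k)⁻¹ = l * (k * g * k⁻¹) * l⁻¹ := by group
  rw [e]
  exact h

lemma C_base {g : A} (n : ℕ) (h : Base g) : C g n := ⟨1, one_mem _, Or.inl (by simpa using h)⟩

lemma C_S {L : List Sy} {n : ℕ} (h : L ≠ []) (hn : sw L ≤ n) : C (S L) n :=
  ⟨1, one_mem _, Or.inr ⟨L, h, by simp, hn⟩⟩

lemma C_mono {g : A} {n m : ℕ} (hnm : n ≤ m) (h : C g n) : C g m := by
  obtain ⟨k, hk, h | ⟨L, h1, h2, h3⟩⟩ := h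
  · exact ⟨k, hk, Or.inl h⟩
  · exact ⟨k, hk, Or.inr ⟨L, h1, h2, h3.trans hnm⟩⟩

lemma base_bs (x : Sy) : Base (bs x) := by
  cases x
  · exact Or.inr (Or.inr (Or.inl rfl))
  · exact Or.inr (Or.inr (Or.inr (Or.inl rfl)))
  · exact Or.inr (Or.inr (Or.inr (Or.inr rfl)))

lemma C_aS (l : ℕ) : ∀ L : List Sy, L.length ≤ l → C (ga * S L) (3 + sw L) := by
  induction l with
  | zero =>
    intro L hL
    have : L = [] := List.length_eq_zero_iff.1 (by omega)
    subst this
    exact C_base _ (Or.inr (Or.inl (by simp [S])))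
  | succ l ih =>
    intro L hL
    cases L with
    | nil => exact C_base _ (Or.inr (Or.inl (by simp [S])))
    | cons y M =>
      rcases List.eq_nil_or_concat M with rfl | ⟨M', x, rfl⟩
      · apply C_conj ga_mem
        apply C_base
        have e : ga * (ga * S [y]) * ga⁻¹ = bs y := by
          simp only [S, mul_one]
          rw [← mul_assoc ga ga, ga_ga]
          group
        rw [e]
        exact base_bs y
      · rw [List.concat_eq_append] at hL ⊢
        have hm : bs x * ga ∈ Γ := mul_mem (bs_mem x) ga_mem
        apply C_conj hm
        have e : bs x * ga * (ga * S (y :: (M' ++ [x]))) * (bs x * ga)⁻¹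
            = (bs x * bs y) * ga * S M' := by
          rw [S, S_append, S, S, ← mul_assoc (bs x * ga) ga, mul_ga_ga]
          group
        rw [e]
        rw [sw_cons, sw_append, sw_cons]
        simp only [List.length_cons, List.length_append, List.length_nil] at hL
        rcases merge x y with h | ⟨z, h, hz⟩
        · rw [h, one_mul]
          exact C_mono (by omega) (ih M' (by omega))
        · rw [h]
          refine C_S (L := z :: M') (by simp) ?_
          rw [sw_cons]
          omega

lemma C_ev (w : List (Option Sy)) : C (ev w) (ww w) := by
  have hq : ∀ q, oq q ∈ Γ := by
    rintro (_ | q)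
    · exact one_mem _
    · exact bs_mem q
  obtain ⟨L, q, ⟨e, h⟩ | ⟨e, h⟩⟩ := nf w
  · apply C_conj (hq q)
    have e2 : oq q * ev w * (oq q)⁻¹ = oq q * S L := by rw [e]; group
    rw [e2]
    cases q with
    | none =>
      rw [oq, one_mul]
      cases L with
      | nil => exact C_base _ (Or.inl rfl)
      | cons y L => exact C_S (by simp) (by omega)
    | some x =>
      rw [oq]
      simp only [wq] at h
      cases L with
      | nil =>
        rw [S, mul_one]
        exact C_base _ (base_bs x)
      | cons y L =>
        rw [sw_cons] at h
        rw [S, ← mul_assoc, ← mul_assoc]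
        rcases merge x y with h' | ⟨z, h', hz⟩
        · rw [h', one_mul]
          exact C_mono (by omega) (C_aS _ L le_rfl)
        · rw [h']
          refine C_S (L := z :: L) (by simp) ?_
          rw [sw_cons]
          omega
  · apply C_conj (hq q)
    have e2 : oq q * ev w * (oq q)⁻¹ = oq q * ga * S L := by rw [e]; group
    rw [e2]
    cases q with
    | none =>
      rw [oq, one_mul]
      exact C_mono (by omega) (C_aS _ L le_rfl)
    | some x =>
      simp only [wq] at h
      refine C_S (L := x :: L) (by simp) ?_
      rw [sw_cons]
      omega

def p0 : Sy → List (Option Sy)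
  | .b => [none]
  | .c => [none]
  | .d => []
def p1 : Sy → List (Option Sy)
  | .b => [some .c]
  | .c => [some .d]
  | .d => [some .b]

lemma ev_p0 (s : Sy) : ev (p0 s) = s0 s := by
  cases s <;> simp [p0, ev, s0, lt]
lemma ev_p1 (s : Sy) : ev (p1 s) = s1 s := by
  cases s <;> simp [p1, ev, s1, lt, bs]
lemma ww_p (s : Sy) : ww (p0 s) + ww (p1 s) < ws s + 3 := by
  cases s <;> decide
lemma ww_append (u v : List (Option Sy)) : ww (u ++ v) = ww u + ww v := by
  simp [ww]

lemma S_sec (L : List Sy) : ∃ u v, (S L = pr (ev u) (ev v) ∨ S L = pr (ev u) (ev v) * ga) ∧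
    ww u + ww v + L.length ≤ sw L := by
  induction L with
  | nil => exact ⟨[], [], Or.inl (by simp [S, ev, pr_one]), by simp [ww, sw]⟩
  | cons x L ih =>
    obtain ⟨u, v, e, h⟩ := ih
    refine ⟨p0 x ++ v, p1 x ++ u, ?_, ?_⟩
    · rw [ev_append, ev_append, ev_p0, ev_p1, ← pr_mul, ← bs_eq, S]
      rcases e with e | e
      · right
        rw [e, ga_pr']
      · left
        rw [e, ← mul_assoc, ga_pr', mul_ga_ga]
    · have := ww_p x
      rw [sw_cons, ww_append, ww_append, List.length_cons]
      omega

lemma D_ev (l : ℕ) : ∀ w, ww w ≤ l → ∃ n, D n (ev w) := by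
  induction l using Nat.strong_induction_on with
  | _ l ih =>
    intro w hw
    obtain ⟨k, hk, h | ⟨L, hL, e, hs⟩⟩ := C_ev w
    · exact ⟨0, k, hk, h⟩
    · obtain ⟨u, v, h, hl⟩ := S_sec L
      have : 0 < L.length := List.length_pos_iff.2 hL
      rcases h with h | h
      · obtain ⟨n, hn⟩ := ih (ww u) (by omega) u le_rfl
        obtain ⟨m, hm⟩ := ih (ww v) (by omega) v le_rfl
        exact ⟨max n m + 1, k, hk, ev u, ev_mem u, ev v, ev_mem v, Or.inl ⟨e.trans h,
          D_mono (le_max_left _ _) hn, D_mono (le_max_right _ _) hm⟩⟩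
      · obtain ⟨n, hn⟩ := ih (ww (u ++ v)) (by rw [ww_append]; omega) _ le_rfl
        rw [ev_append] at hn
        exact ⟨n + 1, k, hk, ev u, ev_mem u, ev v, ev_mem v, Or.inr ⟨e.trans h, hn⟩⟩

lemma D_all {x : A} (hx : x ∈ Γ) : ∃ n, D n x := by
  obtain ⟨w, rfl⟩ := exists_ev hx
  exact D_ev _ w le_rfl

lemma P_mixed {n : ℕ} {x0 x1 y0 y1 : A} (hx : pr x0 x1 ∈ Γ) (hy : pr y0 y1 * ga ∈ Γ) :
    P n (pr x0 x1) (pr y0 y1 * ga) := by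
  refine P_of_ne hx hy isChar1 ?_
  rw [χ1_ga, χ1_pr (sec_mem hx).2]
  decide

lemma P_mixed' {n : ℕ} {x0 x1 y0 y1 : A} (hx : pr x0 x1 ∈ Γ) (hy : pr y0 y1 * ga ∈ Γ) :
    P n (pr y0 y1 * ga) (pr x0 x1) := by
  refine P_of_ne hy hx isChar1 ?_
  rw [χ1_ga, χ1_pr (sec_mem hx).2]
  decide

lemma P_D (n : ℕ) : ∀ x y, x ∈ Γ → y ∈ Γ → D n x → D n y → P 0 x y := by
  induction n with
  | zero =>
    rintro x y hx hy ⟨g, hg, h⟩ ⟨g', hg', h'⟩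
    exact P_conj_left hg (P_conj_right hg' (P_base h h'))
  | succ n ih =>
    rintro x y hx hy ⟨g, hg, x0, hx0, x1, hx1, h⟩ ⟨g', hg', y0, hy0, y1, hy1, h'⟩
    have mx := mul_mem (mul_mem hg hx) (inv_mem hg)
    have my := mul_mem (mul_mem hg' hy) (inv_mem hg')
    apply P_conj_left hg
    apply P_conj_right hg'
    rcases h with ⟨e, d0, d1⟩ | ⟨e, d⟩ <;> rcases h' with ⟨e', d0', d1'⟩ | ⟨e', d'⟩ <;>
      rw [e] at mx <;> rw [e'] at my <;> rw [e, e']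
    · exact P_desc (P_succ_st (ih _ _ hx0 hy0 d0 d0') (ih _ _ hx1 hy1 d1 d1')
        (ih _ _ hx0 hy1 d0 d1') (ih _ _ hx1 hy0 d1 d0'))
    · exact P_mixed mx my
    · exact P_mixed' my mx
    · exact P_desc (P_succ_sw hx0 hx1 hy0 (ih _ _ (mul_mem hx0 hx1) (mul_mem hy0 hy1) d d'))

lemma P_all (n : ℕ) : ∀ x y, x ∈ Γ → y ∈ Γ → P n x y := by
  induction n with
  | zero =>
    intro x y hx hy
    obtain ⟨n, hn⟩ := D_all hx
    obtain ⟨m, hm⟩ := D_all hy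
    exact P_D (max n m) x y hx hy (D_mono (le_max_left _ _) hn) (D_mono (le_max_right _ _) hm)
  | succ n ih =>
    intro x y hx hy
    obtain ⟨x0, x1, hx0, hx1, rfl | rfl⟩ := dec hx <;>
      obtain ⟨y0, y1, hy0, hy1, rfl | rfl⟩ := dec hy
    · exact P_succ_st (ih _ _ hx0 hy0) (ih _ _ hx1 hy1) (ih _ _ hx0 hy1) (ih _ _ hx1 hy0)
    · exact P_mixed hx hy
    · exact P_mixed' hy hx
    · exact P_succ_sw hx0 hx1 hy0 (ih _ _ (mul_mem hx0 hx1) (mul_mem hy0 hy1))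

/-! ### torsion -/

lemma pow_conj {x g : A} {k : ℕ} (h : (g * x * g⁻¹) ^ k = 1) : x ^ k = 1 := by
  rw [conj_pow] at h
  simpa using h

lemma pr_pow (u v : A) (k : ℕ) : (pr u v) ^ k = pr (u ^ k) (v ^ k) := by
  induction k with
  | zero => simp [pr_one]
  | succ k ih => rw [pow_succ, ih, pr_mul, pow_succ, pow_succ]

lemma pow_le {x : A} {k l : ℕ} (h : k ≤ l) (hx : x ^ 2 ^ k = 1) : x ^ 2 ^ l = 1 := by
  obtain ⟨m, rfl⟩ := Nat.exists_eq_add_of_le h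
  rw [pow_add, pow_mul, hx, one_pow]

lemma tors (n : ℕ) : ∀ x, D n x → ∃ k, x ^ 2 ^ k = 1 := by
  induction n with
  | zero =>
    rintro x ⟨g, hg, h⟩
    refine ⟨1, pow_conj (g := g) ?_⟩
    rcases h with h | h | h | h | h <;> rw [h, pow_one, pow_two]
    · exact one_mul 1
    · exact ga_ga
    · exact gb_gb
    · exact gc_gc
    · exact gd_gd
  | succ n ih =>
    rintro x ⟨g, hg, x0, hx0, x1, hx1, ⟨e, d0, d1⟩ | ⟨e, d⟩⟩
    · obtain ⟨k, hk⟩ := ih _ d0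
      obtain ⟨l, hl⟩ := ih _ d1
      refine ⟨max k l, pow_conj (g := g) ?_⟩
      rw [e, pr_pow, pow_le (le_max_left k l) hk, pow_le (le_max_right k l) hl, pr_one]
    · obtain ⟨k, hk⟩ := ih _ d
      refine ⟨k + 1, pow_conj (g := g) ?_⟩
      have e2 : (pr x0 x1 * ga) ^ 2 = pr (x0 * x1) (x1 * x0) := by
        rw [pow_two, ← mul_assoc, ga_pr', mul_ga_ga, pr_mul]
      have e3 : (x1 * x0) ^ 2 ^ k = 1 := by
        apply pow_conj (g := x0)
        have : x0 * (x1 * x0) * x0⁻¹ = x0 * x1 := by group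
        rw [this, hk]
      rw [e, pow_succ', pow_mul, e2, pr_pow, hk, e3, pr_one]

lemma isP : IsPGroup 2 ↥Γ := by
  intro g
  obtain ⟨n, hn⟩ := D_all g.2
  obtain ⟨k, hk⟩ := tors n _ hn
  exact ⟨k, Subtype.ext (by simpa using hk)⟩

/-! ### cofinality -/

lemma Kn_le_lcs (m : ℕ) : Kn m ≤ Subgroup.lowerCentralSeries Grigorchuk m := by
  induction m with
  | zero => exact Kn_le 0
  | succ m ih => exact (Kn_le_comm m).trans (Subgroup.commutator_mono ih le_rfl)

lemma cofinal (N : Subgroup ↥Γ) [N.Normal] [N.FiniteIndex] :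
    ∃ m, ∀ x : ↥Γ, (x : A) ∈ Kn m → x ∈ N := by
  have : Finite (↥Γ ⧸ N) := Subgroup.finite_quotient_of_finiteIndex
  have hp : IsPGroup 2 (↥Γ ⧸ N) := isP.to_quotient N
  haveI : Fact (Nat.Prime 2) := ⟨Nat.prime_two⟩
  have hn : Group.IsNilpotent (↥Γ ⧸ N) := hp.isNilpotent
  obtain ⟨m, hm⟩ := Subgroup.nilpotent_iff_lowerCentralSeries.1 hn
  refine ⟨m, fun x hx => ?_⟩
  have hx2 := Kn_le_lcs m hx
  rw [← Subgroup.top_subtype_lowerCentralSeries] at hx2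
  obtain ⟨y, hy, e⟩ := hx2
  have : y = x := Subtype.ext e
  subst this
  have h2 := Subgroup.mem_map_of_mem (QuotientGroup.mk' N) hy
  rw [Subgroup.map_lowerCentralSeries, Subgroup.map_top_of_surjective _
    (QuotientGroup.mk'_surjective N)] at h2
  rw [hm, Subgroup.mem_bot] at h2
  exact (QuotientGroup.eq_one_iff y).1 h2

lemma key (H : Subgroup ↥Γ) [H.FiniteIndex] (x y : ↥Γ)
    (h : ∀ k ∈ H, k * x * k⁻¹ ≠ y) :
    ∃ n, ∀ k ∈ H, ((k * x * k⁻¹ * y⁻¹ : ↥Γ) : A) ∉ Kn n := by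
  by_contra hc
  push Not at hc
  obtain ⟨m, hm⟩ := cofinal H.normalCore
  obtain ⟨z, hz, ⟨-, ⟨z', hz', ez⟩, -⟩, h2⟩ := pigeon m
    (fun n k => (∃ k' ∈ H, (k' : A) = k) ∧ k * x * k⁻¹ * (y : A)⁻¹ ∈ Kn n)
    (fun n n' k hn hk => ⟨hk.1, Kn_anti hn hk.2⟩)
    (fun n => by
      obtain ⟨k, hk, h1⟩ := hc n
      exact ⟨k, k.2, ⟨k, hk, rfl⟩, by simpa using h1⟩)
  obtain ⟨k, hk, a1, a2⟩ := P_all m x y x.2 y.2 z hz (fun n => by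
    obtain ⟨k, hk, b1, b2, b3⟩ := h2 n
    exact ⟨k, hk, b1, b3⟩)
  subst ez
  refine h ⟨k, hk⟩ ?_ (Subtype.ext (by simpa using a2))
  have := H.normalCore_le (hm (z'⁻¹ * ⟨k, hk⟩) (by simpa using a1))
  simpa using H.mul_mem hz' this

def KH (H : Subgroup ↥Γ) (n : ℕ) : Subgroup ↥H := ((Kn n).subgroupOf Γ).subgroupOf H

lemma mem_KH {H : Subgroup ↥Γ} {n : ℕ} {x : ↥H} : x ∈ KH H n ↔ ((x : ↥Γ) : A) ∈ Kn n := by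
  rw [KH, Subgroup.mem_subgroupOf, Subgroup.mem_subgroupOf]

lemma KH_normal (H : Subgroup ↥Γ) (n : ℕ) : (KH H n).Normal := by
  constructor
  intro x hx g
  rw [mem_KH] at hx ⊢
  have := Kn_conj n (g : ↥Γ).2 hx
  simpa using this

lemma KH_finite (H : Subgroup ↥Γ) (n : ℕ) : Finite (↥H ⧸ KH H n) := by
  obtain ⟨T, hT, f, hf⟩ := colour n
  refine Finite.of_injective (fun q : ↥H ⧸ KH H n => f ((q.out : ↥Γ) : A)) ?_
  intro q q' e
  have := hf _ (q.out : ↥Γ).2 _ (q'.out : ↥Γ).2 e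
  rw [← QuotientGroup.out_eq' q, ← QuotientGroup.out_eq' q', QuotientGroup.eq, mem_KH]
  simpa using this

lemma KH_sep (H : Subgroup ↥Γ) [H.FiniteIndex] (x y : ↥H) (h : ¬ IsConj x y) :
    ∃ n, haveI := KH_normal H n; ¬ IsConj (QuotientGroup.mk x : ↥H ⧸ KH H n) (QuotientGroup.mk y) := by
  obtain ⟨n, hn⟩ := key H x y (fun k hk e => h (isConj_iff.2 ⟨⟨k, hk⟩, Subtype.ext (by simpa using e)⟩))
  refine ⟨n, ?_⟩
  haveI := KH_normal H n
  intro hc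
  obtain ⟨c, hc⟩ := isConj_iff.1 hc
  obtain ⟨k, rfl⟩ := QuotientGroup.mk_surjective c
  rw [← QuotientGroup.mk_inv, ← QuotientGroup.mk_mul, ← QuotientGroup.mk_mul, eq_comm,
    QuotientGroup.eq, mem_KH] at hc
  apply hn k k.2
  have := Kn_conj n (y : ↥Γ).2 hc
  convert this using 1
  simp [mul_assoc]

lemma sep1 (H : Subgroup ↥Γ) [H.FiniteIndex] : IsConjSeparable ↥H := by
  intro x y h
  obtain ⟨n, hn⟩ := KH_sep H x y h
  haveI := KH_finite H n
  exact ⟨KH H n, KH_normal H n, Subgroup.finiteIndex_of_finite_quotient, hn⟩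

lemma sep2 (H : Subgroup ↥Γ) [H.FiniteIndex] : pConjSep 2 ↥H := by
  intro x y h
  obtain ⟨n, hn⟩ := KH_sep H x y h
  haveI := KH_normal H n
  exact ⟨KH H n, ⟨KH_normal H n, KH_finite H n, (isP.to_subgroup H).to_quotient _⟩,
    KH_normal H n, hn⟩

lemma sepΓ : pConjSep 2 ↥Γ := by
  intro x y h
  obtain ⟨n, hn⟩ := key ⊤ x y (fun k _ e => h (isConj_iff.2 ⟨k, e⟩))
  have hN : ((Kn n).subgroupOf Γ).Normal := by
    constructor
    intro x hx g
    rw [Subgroup.mem_subgroupOf] at hx ⊢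
    exact Kn_conj n g.2 hx
  have hF : Finite (↥Γ ⧸ (Kn n).subgroupOf Γ) := by
    obtain ⟨T, hT, f, hf⟩ := colour n
    refine Finite.of_injective (fun q : ↥Γ ⧸ (Kn n).subgroupOf Γ => f (q.out : A)) ?_
    intro q q' e
    have := hf _ (q.out).2 _ (q'.out).2 e
    rw [← QuotientGroup.out_eq' q, ← QuotientGroup.out_eq' q', QuotientGroup.eq,
      Subgroup.mem_subgroupOf]
    simpa using this
  refine ⟨_, ⟨hN, hF, isP.to_quotient _⟩, hN, ?_⟩
  intro hc
  obtain ⟨c, hc⟩ := isConj_iff.1 hc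
  obtain ⟨k, rfl⟩ := QuotientGroup.mk_surjective c
  rw [← QuotientGroup.mk_inv, ← QuotientGroup.mk_mul, ← QuotientGroup.mk_mul, eq_comm,
    QuotientGroup.eq, Subgroup.mem_subgroupOf] at hc
  apply hn k trivial
  have := Kn_conj n y.2 hc
  convert this using 1
  simp [mul_assoc]

end Grig

/-- The Grigorchuk group is hereditarily conjugacy separable; in
particular it is `2`-hereditarily conjugacy separable. -/
theorem grigorchuk_hereditarily_conjSep :
    IsHereditarilyConjSeparable ↥Grigorchuk ∧ pHCS 2 ↥Grigorchuk := by
  refine ⟨fun H hH => Grig.sep1 H, Grig.sepΓ, fun H hH => ?_⟩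
  obtain ⟨N, ⟨hN, hF, -⟩, hle⟩ := hH
  haveI : N.FiniteIndex := Subgroup.finiteIndex_of_finite_quotient
  haveI : H.FiniteIndex := Subgroup.finiteIndex_of_le hle
  exact Grig.sep2 H
end

section
/- Let 𝒞 be an extension-closed pseudo-variety of finite groups and let G be a group in which every cyclic subgroup is 𝒞-separable in G. Then for every g ∈ G of infinite order and every integer N > 0 there exist a subgroup K ∈ N_𝒞(G) and a positive integer c such that ⟨g⟩ ∩ K = ⟨g^{cN}⟩; in particular, the order of the image of g in G/K is a multiple of N. -/
open Pointwise

universe u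

theorem ECPseudoVariety.coC_inf (V : ECPseudoVariety.{u}) {G : Type u} [Group G]
    {K L : Subgroup G} (hK : K ∈ V.coC G) (hL : L ∈ V.coC G) : K ⊓ L ∈ V.coC G := by
  obtain ⟨nK, mK⟩ := hK
  obtain ⟨nL, mL⟩ := hL
  refine ⟨inferInstance, ?_⟩
  let f : G →* (G ⧸ K) × (G ⧸ L) := (QuotientGroup.mk' K).prod (QuotientGroup.mk' L)
  have hf : f.ker = K ⊓ L := by
    ext x
    simp [f, MonoidHom.mem_ker, Prod.ext_iff, Subgroup.mem_inf]
  have h1 : V.mem f.range := V.subgroup_closed _ _ (V.prod_closed _ _ mK mL)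
  exact V.iso_closed _ _
    ((QuotientGroup.quotientKerEquivRange f).symm.trans
      (QuotientGroup.quotientMulEquivOfEq hf)) h1

theorem ECPseudoVariety.exists_avoid (V : ECPseudoVariety.{u}) (G : Type u) [Group G]
    (hcss : ∀ x : G, V.CSeparable ((Subgroup.zpowers x : Subgroup G) : Set G))
    (g : G) (hg : ¬ IsOfFinOrder g) (N : ℕ) (n : ℕ) :
    ∃ K ∈ V.coC G, ∀ i : ℕ, 0 < i → i < n → i < N →
      ∀ b : ℤ, (g ^ ((N : ℤ) * b))⁻¹ * g ^ i ∉ K := by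
  induction n with
  | zero =>
    have h1 : g ∉ ((Subgroup.zpowers (1 : G) : Subgroup G) : Set G) := by
      intro h
      apply hg
      have : g = 1 := by simpa using h
      rw [this]; exact IsOfFinOrder.one
    obtain ⟨K, hK, -⟩ := hcss 1 g h1
    exact ⟨K, hK, fun i _ h => absurd h (Nat.not_lt_zero _)⟩
  | succ n ih =>
    obtain ⟨K, hK, h⟩ := ih
    by_cases hn : 0 < n ∧ n < N
    · have h1 : g ^ n ∉ ((Subgroup.zpowers (g ^ N) : Subgroup G) : Set G) := by
        rintro ⟨k, hk⟩
        have hk' : g ^ ((N : ℤ) * k) = g ^ (n : ℤ) := by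
          rw [zpow_mul]; simpa using hk
        have := (injective_zpow_iff_not_isOfFinOrder.mpr hg) hk'
        have hd : (N : ℤ) ∣ n := ⟨k, this.symm⟩
        have := Nat.le_of_dvd hn.1 (Int.natCast_dvd_natCast.mp hd)
        omega
      obtain ⟨L, hL, hL2⟩ := hcss _ _ h1
      refine ⟨K ⊓ L, V.coC_inf hK hL, ?_⟩
      intro i h0 hi hiN b hb
      rcases Nat.lt_succ_iff_lt_or_eq.mp hi with hi | rfl
      · exact h i h0 hi hiN b hb.1
      · refine hL2 ⟨g ^ ((N : ℤ) * b), ⟨b, ?_⟩, ?_⟩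
        · simp [zpow_mul]
        · exact QuotientGroup.eq.mpr hb.2
    · refine ⟨K, hK, fun i h0 hi hiN => h i h0 ?_ hiN⟩
      by_contra hc
      have : i = n := by omega
      subst this
      exact hn ⟨h0, hiN⟩

/-- If every cyclic subgroup of `G` is `𝒞`-separable, then for every
`g ∈ G` of infinite order and every `N > 0` there are `K ∈ N_𝒞(G)` and `c > 0` with
`⟨g⟩ ⊓ K = ⟨g^(c*N)⟩`; in particular the order of the image of `g` in `G/K` is a
multiple of `N`. -/
theorem order_multiple_in_quotient (V : ECPseudoVariety.{u}) (G : Type u) [Group G]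
    (hcss : ∀ x : G, V.CSeparable ((Subgroup.zpowers x : Subgroup G) : Set G))
    (g : G) (hg : ¬ IsOfFinOrder g) (N : ℕ) (hN : 0 < N) :
    ∃ K ∈ V.coC G, ∃ c : ℕ, 0 < c ∧
      Subgroup.zpowers g ⊓ K = Subgroup.zpowers (g ^ (c * N)) ∧
      ∃ hK : K.Normal, haveI := hK;
        N ∣ orderOf (QuotientGroup.mk g : G ⧸ K) := by
  obtain ⟨K, hK, h⟩ := V.exists_avoid G hcss g hg N N
  refine ⟨K, hK, ?_⟩
  obtain ⟨nK, mK⟩ := hK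
  haveI := V.finite _ mK
  have hpos : 0 < orderOf (QuotientGroup.mk g : G ⧸ K) := orderOf_pos _
  have hmem : ∀ k : ℤ, g ^ k ∈ K ↔ (orderOf (QuotientGroup.mk g : G ⧸ K) : ℤ) ∣ k := by
    intro k
    rw [orderOf_dvd_iff_zpow_eq_one, ← QuotientGroup.mk_zpow, QuotientGroup.eq_one_iff]
  have hdvd : N ∣ orderOf (QuotientGroup.mk g : G ⧸ K) := by
    set m := orderOf (QuotientGroup.mk g : G ⧸ K) with hm
    by_contra hc
    have hd0 : 0 < Nat.gcd m N := Nat.gcd_pos_of_pos_right _ hN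
    have hdN : Nat.gcd m N < N := by
      refine lt_of_le_of_ne (Nat.gcd_le_right _ hN) fun he => hc ?_
      rw [← he]; exact Nat.gcd_dvd_left _ _
    refine h _ hd0 hdN hdN (Nat.gcdB m N) ?_
    rw [← zpow_natCast g (Nat.gcd m N), ← zpow_neg, ← zpow_add, hmem, Nat.gcd_eq_gcd_ab]
    exact ⟨Nat.gcdA m N, by ring⟩
  obtain ⟨c, hc⟩ := id hdvd
  refine ⟨c, ?_, ?_, nK, hdvd⟩
  · rcases Nat.eq_zero_or_pos c with rfl | h0
    · rw [hc] at hpos; simp at hpos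
    · exact h0
  · rw [mul_comm c N, ← hc]
    ext x
    rw [Subgroup.mem_inf, Subgroup.mem_zpowers_iff, Subgroup.mem_zpowers_iff]
    constructor
    · rintro ⟨⟨k, rfl⟩, hk⟩
      obtain ⟨j, rfl⟩ := (hmem k).mp hk
      exact ⟨j, by rw [zpow_mul, zpow_natCast]⟩
    · rintro ⟨j, rfl⟩
      rw [← zpow_natCast g, ← zpow_mul]
      exact ⟨⟨_, rfl⟩, (hmem _).mpr ⟨j, rfl⟩⟩
end

section
/- Let 𝒞 be an extension-closed pseudo-variety of finite groups, let G be a 𝒞-hereditarily conjugacy separable group, and let R ≤ G be a 𝒞-virtual retract of G, i.e., there is a 𝒞-open subgroup H ≤ G with R ≤ H and a homomorphism ρ : H → R with ρ(r) = r for all r ∈ R. Then R is 𝒞-hereditarily conjugacy separable. -/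
open Pointwise

universe u

namespace ECPseudoVariety

lemma mem_of_inj (V : ECPseudoVariety.{u}) {A B : Type u} [Group A] [Group B] (f : A →* B)
    (hf : Function.Injective f) (h : V.mem B) : V.mem A :=
  V.iso_closed _ _ (MonoidHom.ofInjective hf).symm (V.subgroup_closed B f.range h)

lemma mem_of_surj (V : ECPseudoVariety.{u}) {A B : Type u} [Group A] [Group B] (f : A →* B)
    (hf : Function.Surjective f) (h : V.mem A) : V.mem B :=
  V.iso_closed _ _ (QuotientGroup.quotientKerEquivOfSurjective f hf) (V.quotient_closed A f.ker h)

lemma ker_coC (V : ECPseudoVariety.{u}) {A B : Type u} [Group A] [Group B] (f : A →* B)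
    (h : V.mem B) : f.ker ∈ V.coC A :=
  ⟨inferInstance, V.mem_of_inj (QuotientGroup.kerLift f) (QuotientGroup.kerLift_injective f) h⟩

lemma comap_coC (V : ECPseudoVariety.{u}) {A B : Type u} [Group A] [Group B] (f : A →* B)
    {N : Subgroup B} (h : N ∈ V.coC B) : N.comap f ∈ V.coC A := by
  obtain ⟨hN, h⟩ := h
  have := V.ker_coC ((QuotientGroup.mk' N).comp f) h
  rwa [← MonoidHom.comap_ker, QuotientGroup.ker_mk'] at this

lemma inf_coC (V : ECPseudoVariety.{u}) {A : Type u} [Group A] {N K : Subgroup A}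
    (hN : N ∈ V.coC A) (hK : K ∈ V.coC A) : N ⊓ K ∈ V.coC A := by
  obtain ⟨hN, h⟩ := hN
  obtain ⟨hK, h'⟩ := hK
  have := V.ker_coC ((QuotientGroup.mk' N).prod (QuotientGroup.mk' K)) (V.prod_closed _ _ h h')
  rwa [MonoidHom.ker_prod, QuotientGroup.ker_mk', QuotientGroup.ker_mk'] at this

lemma mono_coC (V : ECPseudoVariety.{u}) {A : Type u} [Group A] {N K : Subgroup A}
    (hN : N ∈ V.coC A) (hK : K.Normal) (hle : N ≤ K) : K ∈ V.coC A := by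
  obtain ⟨hN, h⟩ := hN
  refine ⟨hK, V.mem_of_surj (QuotientGroup.map N K (MonoidHom.id A) hle) ?_ h⟩
  intro x
  induction x using QuotientGroup.induction_on with
  | H x => exact ⟨(x : A ⧸ N), rfl⟩

lemma top_coC (V : ECPseudoVariety.{u}) {A : Type u} [Group A] {N : Subgroup A}
    (hN : N ∈ V.coC A) : ⊤ ∈ V.coC A := V.mono_coC hN inferInstance le_top

lemma iInf_coC (V : ECPseudoVariety.{u}) {A : Type u} [Group A] {ι : Type u} [Finite ι]
    (f : ι → Subgroup A) {N : Subgroup A} (hN : N ∈ V.coC A)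
    (h : ∀ i, f i ∈ V.coC A) : (⨅ i, f i) ∈ V.coC A := by
  classical
  cases nonempty_fintype ι
  have : ∀ s : Finset ι, s.inf f ∈ V.coC A := by
    intro s
    induction s using Finset.induction_on with
    | empty => simpa using V.top_coC hN
    | insert a s ha ih => rw [Finset.inf_insert]; exact V.inf_coC (h a) ih
  simpa [Finset.inf_univ_eq_iInf] using this Finset.univ

lemma ext_coC (V : ECPseudoVariety.{u}) {A : Type u} [Group A] {D M : Subgroup A}
    (hD : D.Normal) (hle : D ≤ M) (hM : M ∈ V.coC A) (h : D.subgroupOf M ∈ V.coC M) :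
    D ∈ V.coC A := by
  obtain ⟨hMn, hM⟩ := hM
  obtain ⟨hn, h⟩ := h
  refine ⟨hD, ?_⟩
  have hmn : (M.map (QuotientGroup.mk' D)).Normal :=
    hMn.map _ (QuotientGroup.mk'_surjective D)
  refine V.extension_closed (A ⧸ D) (M.map (QuotientGroup.mk' D)) ?_ ?_
  · refine V.mem_of_surj (QuotientGroup.lift (D.subgroupOf M)
      ((QuotientGroup.mk' D).subgroupMap M) ?_) ?_ h
    · intro x hx
      apply Subtype.ext
      exact (QuotientGroup.eq_one_iff _).2 hx
    · intro y
      obtain ⟨x, hx⟩ := (QuotientGroup.mk' D).subgroupMap_surjective M y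
      exact ⟨(x : M ⧸ D.subgroupOf M), hx⟩
  · exact V.iso_closed _ _ (QuotientGroup.quotientQuotientEquivQuotient D M hle).symm hM

lemma copen_trans (V : ECPseudoVariety.{u}) {G : Type u} [Group G] {H : Subgroup G}
    (hH : V.COpen H) {K : Subgroup H} (hK : V.COpen K) : V.COpen (K.map H.subtype) := by
  obtain ⟨M, hM, hMH⟩ := hH
  obtain ⟨L, hL, hLK⟩ := hK
  obtain ⟨hMn, hMq⟩ := id hM
  have hA := V.comap_coC (Subgroup.inclusion hMH) hL
  set A := L.comap (Subgroup.inclusion hMH) with hAdef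
  have hAn : A.Normal := hA.1
  have := V.finite _ hMq
  have hI := V.iInf_coC (fun q : G ⧸ M => A.comap (MulAut.conjNormal q.out⁻¹ : MulAut M).toMonoidHom)
    hA (fun q => V.comap_coC _ hA)
  have hle : (A.map M.subtype).normalCore ≤ M :=
    (Subgroup.normalCore_le _).trans (Subgroup.map_subtype_le _)
  refine ⟨(A.map M.subtype).normalCore, V.ext_coC inferInstance hle hM
    (V.mono_coC hI inferInstance ?_), ?_⟩
  · intro m hm g
    rw [Subgroup.mem_iInf] at hm
    obtain ⟨n, hn⟩ := QuotientGroup.mk_out_eq_mul M g⁻¹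
    have h1 : MulAut.conjNormal ((g⁻¹ : G) : G ⧸ M).out⁻¹ m ∈ A := hm _
    rw [hn] at h1
    have h2 := hAn.conj_mem _ h1 n
    refine ⟨_, h2, ?_⟩
    simp only [Subgroup.subtype_apply, Subgroup.coe_mul, MulAut.conjNormal_apply,
      Subgroup.coe_inv]
    group
  · intro x hx
    obtain ⟨a, ha, rfl⟩ := Subgroup.normalCore_le _ hx
    exact ⟨Subgroup.inclusion hMH a, hLK ha, rfl⟩

lemma conjSep_retract (V : ECPseudoVariety.{u}) {A B : Type u} [Group A] [Group B]
    (i : A →* B) (r : B →* A) (hri : ∀ a, r (i a) = a) (hB : V.ConjSep B) : V.ConjSep A := by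
  intro g x hx
  obtain ⟨N, hN, h⟩ := hB (i g) (i x) (fun hc => hx (by
    have h1 : IsConj (i g) (i x) := hc
    have h2 := MonoidHom.map_isConj r h1
    rw [hri, hri] at h2
    exact h2))
  refine ⟨N.comap i, V.comap_coC i hN, ?_⟩
  rintro ⟨y, hy, he⟩
  refine h ⟨i y, MonoidHom.map_isConj i hy, ?_⟩
  rw [QuotientGroup.eq] at he ⊢
  simpa using he

end ECPseudoVariety

/-- A `𝒞`-virtual retract of a `𝒞`-hereditarily conjugacy separable
group is `𝒞`-hereditarily conjugacy separable. -/
theorem virtual_retract_CHCS (V : ECPseudoVariety.{u}) (G : Type u) [Group G]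
    (hG : V.HCS G) (H R : Subgroup G) (hH : V.COpen H) (hRH : R ≤ H)
    (ρ : H →* R) (hρ : ∀ (r : G) (hr : r ∈ R), ρ ⟨r, hRH hr⟩ = ⟨r, hr⟩) :
    V.HCS R := by
  refine ⟨V.conjSep_retract (Subgroup.inclusion hRH) ρ (fun a => hρ a.1 a.2) (hG.2 H hH), ?_⟩
  intro R' hR'
  have hK : V.COpen (R'.comap ρ) := by
    obtain ⟨N, hN, hle⟩ := hR'
    exact ⟨N.comap ρ, V.comap_coC ρ hN, Subgroup.comap_mono hle⟩
  have hS := hG.2 _ (V.copen_trans hH hK)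
  have hS' : V.ConjSep (R'.comap ρ) := by
    let e := (R'.comap ρ).equivMapOfInjective H.subtype H.subtype_injective
    exact V.conjSep_retract e.toMonoidHom e.symm.toMonoidHom (fun a => e.symm_apply_apply a) hS
  refine V.conjSep_retract (B := R'.comap ρ)
    (((Subgroup.inclusion hRH).comp R'.subtype).codRestrict (R'.comap ρ) ?_)
    (ρ.subgroupComap R') ?_ hS'
  · intro x
    have : ρ (Subgroup.inclusion hRH x.1) = x.1 := hρ x.1.1 x.1.2
    change ρ (Subgroup.inclusion hRH x.1) ∈ R'
    rw [this]; exact x.2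
  · intro x
    exact Subtype.ext (hρ x.1.1 x.1.2)
end

section
/- Let 𝒞 be an extension-closed pseudo-variety of finite groups and G a group. An element g ∈ G satisfies the 𝒞-centralizer condition in G if and only if for every subgroup K ∈ N_𝒞(G) there exists a group Q and a surjective homomorphism π : G → Q such that ker(π) ≤ K, the element π(g) satisfies the 𝒞-centralizer condition in Q, and C_Q(π(g)) ⊆ π(C_G(g)·K) in Q. -/
open Pointwise

universe u

lemma coC_comap_iff (V : ECPseudoVariety.{u}) {G Q : Type u} [Group G] [Group Q]
    (π : G →* Q) (hπ : Function.Surjective π) (N : Subgroup Q) [N.Normal] :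
    N.comap π ∈ V.coC G ↔ N ∈ V.coC Q := by
  have hk : ((QuotientGroup.mk' N).comp π).ker = N.comap π := by
    ext x
    simp [MonoidHom.mem_ker]
  have hs : Function.Surjective ((QuotientGroup.mk' N).comp π) :=
    (QuotientGroup.mk'_surjective N).comp hπ
  let e : G ⧸ N.comap π ≃* Q ⧸ N := (QuotientGroup.quotientMulEquivOfEq hk.symm).trans
    (QuotientGroup.quotientKerEquivOfSurjective _ hs)
  constructor
  · rintro ⟨_, h⟩
    exact ⟨inferInstance, V.iso_closed _ _ e h⟩
  · rintro ⟨_, h⟩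
    exact ⟨inferInstance, V.iso_closed _ _ e.symm h⟩

/-- An element `g` satisfies the `𝒞`-centralizer condition in `G` iff
for every `K ∈ N_𝒞(G)` there is a surjection `π : G → Q` with `ker π ≤ K` such that
`π g` satisfies the `𝒞`-centralizer condition in `Q` and
`C_Q(π g) ⊆ π(C_G(g) K)`. -/
theorem satisfiesCCAt_iff_exists_quotient (V : ECPseudoVariety.{u}) {G : Type u}
    [Group G] (g : G) :
    V.SatisfiesCCAt g ↔
      ∀ K ∈ V.coC G, ∃ (Q : Type u) (instQ : Group Q),
        haveI := instQ;
        ∃ π : G →* Q, Function.Surjective ⇑π ∧ π.ker ≤ K ∧ V.SatisfiesCCAt (π g) ∧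
          (Subgroup.centralizer {π g} : Set Q) ⊆
            ⇑π '' ((Subgroup.centralizer {g} : Set G) * (K : Set G)) := by
  constructor
  · intro h K _
    refine ⟨G, inferInstance, MonoidHom.id G, Function.surjective_id, ?_, h, ?_⟩
    · intro x hx
      have : x = 1 := hx
      exact this ▸ K.one_mem
    · intro x hx
      exact ⟨x, ⟨x, hx, 1, K.one_mem, mul_one x⟩, rfl⟩
  · intro h K hK
    obtain ⟨Q, instQ, π, hπ, hker, hcc, hcent⟩ := h K hK
    have hKn : K.Normal := hK.1
    have hMn : (K.map π).Normal := hKn.map π hπ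
    have hcm : (K.map π).comap π = K := Subgroup.comap_map_eq_self hker
    have hM : K.map π ∈ V.coC Q := by
      rw [← coC_comap_iff V π hπ, hcm]
      exact hK
    obtain ⟨L, hL, hLM, hLn, hw⟩ := hcc _ hM
    have hLK : L.comap π ≤ K := by
      rw [← hcm]
      exact Subgroup.comap_mono hLM
    refine ⟨L.comap π, (coC_comap_iff V π hπ L).2 hL, hLK, inferInstance, ?_⟩
    intro y hy
    obtain ⟨x, rfl⟩ := QuotientGroup.mk_surjective y
    refine ⟨x, ?_, rfl⟩
    have hx : (QuotientGroup.mk (π x) : Q ⧸ L) ∈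
        Subgroup.centralizer {(QuotientGroup.mk (π g) : Q ⧸ L)} := by
      have h1 : (QuotientGroup.mk (g * x) : G ⧸ L.comap π) = QuotientGroup.mk (x * g) :=
        Subgroup.mem_centralizer_iff.1 hy _ rfl
      rw [QuotientGroup.eq, Subgroup.mem_comap] at h1
      rw [Subgroup.mem_centralizer_iff]
      rintro _ rfl
      change (QuotientGroup.mk (π g * π x) : Q ⧸ L) = QuotientGroup.mk (π x * π g)
      rw [QuotientGroup.eq]
      simpa using h1
    obtain ⟨z, ⟨c, hc, m, hm, rfl⟩, hz⟩ := hw hx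
    obtain ⟨w, ⟨a, ha, k, hk, rfl⟩, rfl⟩ := hcent hc
    refine ⟨a, ha, a⁻¹ * x, ?_, by simp⟩
    have hz' := hLM (QuotientGroup.eq.1 hz)
    have hk' : π k ∈ K.map π := Subgroup.mem_map_of_mem π hk
    have : π (a⁻¹ * x) ∈ K.map π := by
      have h2 := mul_mem (mul_mem hk' hm) hz'
      convert h2 using 1
      simp only [map_mul, map_inv]
      group
    rw [SetLike.mem_coe, ← hcm]
    exact this
end
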